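/- arXiv:2112.05599 — 3 statements merged into one kernel-verified Lean document; each statement's English description precedes it below -/
import Mathlib

section
/- Let A be a Noetherian ring and M a finitely generated A[z]-module. Suppose there exists a sequence of integers r_j tending to infinity and A[z]-module endomorphisms w_j : M → M such that w_j^{r_j} coincides with multiplication by z. Then M is finitely generated as an A-module. -/
open Filter

open Polynomial in
theorem isIntegral_of_mem_adjoin_inv {A K : Type*} [CommRing A] [Field K] [Algebra A K]
    {z : K} (hz : z ∈ Algebra.adjoin A {z⁻¹}) : IsIntegral A z := by
  obtain rfl | hz0 := eq_or_ne z 0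
  · exact isIntegral_zero
  obtain ⟨p, hp⟩ := (Algebra.adjoin_singleton_eq_range_aeval A z⁻¹).le hz
  let : Invertible z⁻¹ := invertibleOfNonzero (inv_ne_zero hz0)
  have key := eval₂_reverse_mul_pow (algebraMap A K) z⁻¹ p
  have hp' : eval₂ (algebraMap A K) z⁻¹ p = z := hp
  rw [hp', invOf_eq_inv, inv_inv, inv_pow, mul_inv_eq_iff_eq_mul₀ (pow_ne_zero _ hz0)] at key
  refine ⟨X ^ (p.natDegree + 1) - p.reverse, monic_X_pow_sub ?_, ?_⟩
  · exact degree_le_natDegree.trans_lt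
      (by exact_mod_cast Nat.lt_succ_of_le (reverse_natDegree_le p))
  · rw [eval₂_sub, eval₂_X_pow, key]
    ring

theorem exists_adjoin_inv_div {A K : Type*} [CommRing A] [Field K] [Algebra A K]
    {z : K} (hz : z ≠ 0) {a : K} (ha : a ∈ Algebra.adjoin A {z}) :
    ∃ b ∈ Algebra.adjoin A {z⁻¹}, ∃ n : ℕ, a = b / z⁻¹ ^ n := by
  obtain ⟨p, rfl⟩ := (Algebra.adjoin_singleton_eq_range_aeval A z).le ha
  let : Invertible z := invertibleOfNonzero hz
  have key := Polynomial.eval₂_reverse_mul_pow (algebraMap A K) z p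
  rw [invOf_eq_inv] at key
  refine ⟨Polynomial.aeval z⁻¹ p.reverse, Polynomial.aeval_mem_adjoin_singleton A _,
    p.natDegree, ?_⟩
  rw [inv_pow, div_inv_eq_mul]
  exact key.symm

theorem isFractionRing_adjoin_inv {A K : Type*} [CommRing A] [Field K] [Algebra A K]
    {z : K} (hz : z ≠ 0)
    (h : ∀ k : K, ∃ a ∈ Algebra.adjoin A {z}, ∃ b ∈ Algebra.adjoin A {z}, k = a / b) :
    IsFractionRing (Algebra.adjoin A {z⁻¹}) K := by
  refine IsFractionRing.of_field _ _ fun k ↦ ?_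
  obtain ⟨a, ha, b, hb, rfl⟩ := h k
  obtain ⟨a', ha', m, rfl⟩ := exists_adjoin_inv_div hz ha
  obtain ⟨b', hb', n, rfl⟩ := exists_adjoin_inv_div hz hb
  have hmem : z⁻¹ ∈ Algebra.adjoin A {z⁻¹} := Algebra.self_mem_adjoin_singleton A _
  refine ⟨⟨a' * z⁻¹ ^ n, mul_mem ha' (pow_mem hmem n)⟩,
    ⟨b' * z⁻¹ ^ m, mul_mem hb' (pow_mem hmem m)⟩, ?_⟩
  rw [div_div_div_eq, mul_comm (z⁻¹ ^ m)]
  rfl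

theorem Ring.ordFrac_algebraMap_ne_one {L F : Type*} [CommRing L] [IsDomain L]
    [IsNoetherianRing L] [Ring.KrullDimLE 1 L] [Field F] [Algebra L F] [IsFractionRing L F]
    {y : L} (hy0 : y ≠ 0) (hy : ¬ IsUnit y) : Ring.ordFrac L (algebraMap L F y) ≠ 1 := by
  have hymem := mem_nonZeroDivisors_of_ne_zero hy0
  have hord : Ring.ord L y ≠ 0 := by
    rwa [Ring.ord, Ne, Module.length_eq_zero_iff, Ideal.Quotient.subsingleton_iff,
      Ideal.span_singleton_eq_top]
  obtain ⟨n, hn⟩ := ENat.ne_top_iff_exists.1 (Ring.ord_ne_top hymem)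
  rw [Ring.ordFrac_eq_ord L hy0, Ring.ordMonoidWithZeroHom_eq_coe L hymem hn.symm]
  rw [← hn] at hord
  intro h
  rw [← WithZero.coe_one, WithZero.coe_inj, ofAdd_eq_one] at h
  exact hord (by exact_mod_cast h)

theorem exists_hom_withZero_ne_one_of_injective {D K L : Type*} [CommRing D] [Field K]
    [Algebra D K] [IsFractionRing D K] [CommRing L] [IsDomain L] [IsNoetherianRing L]
    [Ring.KrullDimLE 1 L] {f : D →+* L} (hf : Function.Injective f) {y : D} (hy0 : y ≠ 0)
    (hy : ¬ IsUnit (f y)) :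
    ∃ v : K →*₀ WithZero (Multiplicative ℤ), v (algebraMap D K y) ≠ 1 := by
  have hinj : Function.Injective ((algebraMap L (FractionRing L)).comp f) :=
    (IsFractionRing.injective _ _).comp hf
  have := hf.isDomain f
  let φ : K →+* FractionRing L := IsFractionRing.lift hinj
  refine ⟨(Ring.ordFrac L).comp φ.toMonoidWithZeroHom, ?_⟩
  have hφ : φ (algebraMap D K y) = algebraMap L (FractionRing L) (f y) :=
    IsFractionRing.lift_algebraMap hinj y
  change Ring.ordFrac L (φ (algebraMap D K y)) ≠ 1
  rw [hφ]
  exact Ring.ordFrac_algebraMap_ne_one ((map_ne_zero_iff _ hf).2 hy0) hy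

theorem exists_hom_withZero_ne_one {D K : Type*} [CommRing D] [IsDomain D] [IsNoetherianRing D]
    [Field K] [Algebra D K] [IsFractionRing D K] {y : D} (hy0 : y ≠ 0) (hy : ¬ IsUnit y) :
    ∃ v : K →*₀ WithZero (Multiplicative ℤ), v (algebraMap D K y) ≠ 1 := by
  obtain ⟨q, hq⟩ := Ideal.nonempty_minimalPrimes (I := Ideal.span {y})
    (by rwa [Ne, Ideal.span_singleton_eq_top])
  have := hq.isPrime
  have hyq : y ∈ q := hq.1.2 (Ideal.mem_span_singleton_self y)
  have hht := Ideal.height_le_one_of_isPrincipal_of_mem_minimalPrimes _ q hq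
  have : Ring.KrullDimLE 1 (Localization.AtPrime q) := by
    rw [Ring.krullDimLE_iff, IsLocalization.AtPrime.ringKrullDim_eq_height q]
    exact_mod_cast hht
  have : IsNoetherianRing (Localization.AtPrime q) :=
    IsLocalization.isNoetherianRing q.primeCompl _ inferInstance
  have : IsDomain (Localization.AtPrime q) :=
    IsLocalization.isDomain_localization q.primeCompl_le_nonZeroDivisors
  have hinj : Function.Injective (algebraMap D (Localization.AtPrime q)) :=
    IsLocalization.injective _ q.primeCompl_le_nonZeroDivisors
  exact exists_hom_withZero_ne_one_of_injective hinj hy0 fun h ↦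
    (IsLocalization.AtPrime.isUnit_to_map_iff (Localization.AtPrime q) q y).1 h hyq

theorem map_eq_one_of_pow_eq_of_tendsto {K : Type*} [Field K]
    (v : K →*₀ WithZero (Multiplicative ℤ)) {z : K} (hz : z ≠ 0) {n : ℕ} (hn : n ≠ 0)
    {r : ℕ → ℕ} (hr : Tendsto r atTop atTop) {d : ℕ → K} (hd : ∀ j, d j ^ r j = z ^ n) :
    v z = 1 := by
  obtain ⟨j, hj⟩ := (hr.eventually_gt_atTop (n * (WithZero.log (v z))).natAbs).exists
  have h := congr_arg (fun x ↦ WithZero.log (v x)) (hd j)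
  simp only [map_pow, WithZero.log_pow, nsmul_eq_mul] at h
  have h0 : (n : ℤ) * WithZero.log (v z) = 0 :=
    Int.eq_zero_of_abs_lt_dvd ⟨_, h.symm⟩ (by rw [Int.abs_eq_natAbs]; exact_mod_cast hj)
  have hlog : WithZero.log (v z) = 0 := by simpa [hn] using h0
  rw [← WithZero.exp_log ((map_ne_zero v).2 hz), hlog, WithZero.exp_zero]

theorem isIntegral_of_forall_pow_eq {A K : Type*} [CommRing A] [IsNoetherianRing A] [Field K]
    [Algebra A K] {z : K}
    (h : ∀ k : K, ∃ a ∈ Algebra.adjoin A {z}, ∃ b ∈ Algebra.adjoin A {z}, k = a / b)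
    {n : ℕ} (hn : n ≠ 0) {r : ℕ → ℕ} (hr : Tendsto r atTop atTop)
    {d : ℕ → K} (hd : ∀ j, d j ^ r j = z ^ n) : IsIntegral A z := by
  obtain rfl | hz := eq_or_ne z 0
  · exact isIntegral_zero
  have := isFractionRing_adjoin_inv hz h
  have : IsNoetherianRing (Algebra.adjoin A {z⁻¹}) := by
    have := Algebra.FiniteType.adjoin_of_finite (R := A) (Set.finite_singleton z⁻¹)
    exact Algebra.FiniteType.isNoetherianRing A _
  by_contra hint
  let y : Algebra.adjoin A {z⁻¹} := ⟨z⁻¹, Algebra.self_mem_adjoin_singleton A _⟩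
  have hy0 : y ≠ 0 := fun h0 ↦ inv_ne_zero hz (congr_arg Subtype.val h0)
  have hyu : ¬ IsUnit y := by
    intro hu
    obtain ⟨b, hb⟩ := hu.exists_right_inv
    have hb' : z⁻¹ * (b : K) = 1 := congr_arg Subtype.val hb
    have hbz : (b : K) = z := by rwa [inv_mul_eq_one₀ hz, eq_comm] at hb'
    have hmem := b.2
    rw [hbz] at hmem
    exact hint (isIntegral_of_mem_adjoin_inv hmem)
  obtain ⟨v, hv⟩ := exists_hom_withZero_ne_one (K := K) hy0 hyu
  refine hv ?_
  change v z⁻¹ = 1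
  rw [map_inv₀, map_eq_one_of_pow_eq_of_tendsto v hz hn hr hd, inv_one]

open TensorProduct in
theorem exists_monic_mem_of_annihilator_le {A M : Type*} [CommRing A] [IsNoetherianRing A]
    [AddCommGroup M] [Module (Polynomial A) M] [Module.Finite (Polynomial A) M]
    {r : ℕ → ℕ} (hr : Tendsto r atTop atTop) {w : ℕ → Module.End (Polynomial A) M}
    (hw : ∀ j (m : M), (w j ^ r j) m = (Polynomial.X : Polynomial A) • m)
    (Q : Ideal (Polynomial A)) [Q.IsPrime] (hQ : Module.annihilator (Polynomial A) M ≤ Q) :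
    ∃ f ∈ Q, f.Monic := by
  let κ := Q.ResidueField
  have hV : Nontrivial (κ ⊗[Polynomial A] M) :=
    (Module.mem_support_iff_nontrivial_residueField_tensorProduct ⟨Q, inferInstance⟩).1
      (Module.mem_support_iff_of_finite.2 hQ)
  let z : κ := algebraMap (Polynomial A) κ Polynomial.X
  have haeval (f : Polynomial A) :
      algebraMap (Polynomial A) κ f = Polynomial.aeval z f := by
    rw [Polynomial.aeval_algebraMap_apply, Polynomial.aeval_X_left_apply]
  have hfrac (k : κ) :
      ∃ a ∈ Algebra.adjoin A {z}, ∃ b ∈ Algebra.adjoin A {z}, k = a / b := by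
    obtain ⟨a, b, -, rfl⟩ := IsFractionRing.div_surjective (A := Polynomial A ⧸ Q) k
    obtain ⟨f, rfl⟩ := Ideal.Quotient.mk_surjective a
    obtain ⟨g, rfl⟩ := Ideal.Quotient.mk_surjective b
    exact ⟨_, Polynomial.aeval_mem_adjoin_singleton A z (p := f), _,
      Polynomial.aeval_mem_adjoin_singleton A z (p := g), by rw [← haeval, ← haeval]; rfl⟩
  have hd (j : ℕ) : LinearMap.det ((w j).baseChange κ) ^ r j =
      z ^ Module.finrank κ (κ ⊗[Polynomial A] M) := by
    have hj : w j ^ r j = (Polynomial.X : Polynomial A) • LinearMap.id := LinearMap.ext (hw j)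
    have hj' : ((w j).baseChange κ) ^ r j = z • LinearMap.id := by
      rw [← LinearMap.baseChange_pow, hj, LinearMap.baseChange_smul, LinearMap.baseChange_id]
      ext; simp [z]
    rw [← map_pow, hj', LinearMap.det_smul, LinearMap.det_id, mul_one]
  obtain ⟨f, hf, hfz⟩ := isIntegral_of_forall_pow_eq hfrac Module.finrank_pos.ne' hr hd
  refine ⟨f, ?_, hf⟩
  rw [← Ideal.algebraMap_residueField_eq_zero, haeval]
  exact hfz

theorem exists_monic_mem_of_forall_isPrime {A : Type*} [CommRing A] (I : Ideal (Polynomial A))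
    (h : ∀ Q : Ideal (Polynomial A), Q.IsPrime → I ≤ Q → ∃ f ∈ Q, f.Monic) :
    ∃ f ∈ I, f.Monic := by
  by_contra! hI
  let S : Submonoid (Polynomial A) :=
    { carrier := {f | f.Monic}
      one_mem' := Polynomial.monic_one
      mul_mem' := Polynomial.Monic.mul }
  obtain ⟨Q, hQ, hIQ, hdisj⟩ := Ideal.exists_le_prime_disjoint I S
    (Set.disjoint_left.2 fun f hf hfS ↦ hI f hf hfS)
  obtain ⟨f, hf, hfm⟩ := h Q hQ hIQ
  exact Set.disjoint_left.1 hdisj hf hfm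

theorem Module.finite_of_monic_mem_annihilator {A M : Type*} [CommRing A] [AddCommGroup M]
    [Module (Polynomial A) M] [Module A M] [IsScalarTower A (Polynomial A) M]
    [Module.Finite (Polynomial A) M] {f : Polynomial A} (hf : f.Monic)
    (hfM : f ∈ Module.annihilator (Polynomial A) M) : Module.Finite A M := by
  have hfin : Module.Finite A (Polynomial A ⧸ Ideal.span {f}) := hf.finite_quotient
  have htors : Module.IsTorsionBySet (Polynomial A) M (Ideal.span {f} : Set (Polynomial A)) := by
    exact (Module.isTorsionBySet_span_singleton_iff f).2 fun m ↦ Module.mem_annihilator.1 hfM m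
  let : Module (Polynomial A ⧸ Ideal.span {f}) M := htors.module
  have : IsScalarTower (Polynomial A) (Polynomial A ⧸ Ideal.span {f}) M := htors.isScalarTower
  have : IsScalarTower A (Polynomial A ⧸ Ideal.span {f}) M := htors.isScalarTower
  have : Module.Finite (Polynomial A ⧸ Ideal.span {f}) M :=
    Module.Finite.of_restrictScalars_finite (Polynomial A) _ _
  exact Module.Finite.trans (Polynomial A ⧸ Ideal.span {f}) M

/-- Let `A` be a Noetherian ring and `M` a finitely generated `A[z]`-module. Suppose there
exists a sequence of integers `r j` tending to infinity and `A[z]`-module endomorphisms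
`w j : M → M` such that `(w j)^(r j)` coincides with multiplication by `z`. Then `M` is
finitely generated as an `A`-module. -/
theorem stmt0 (A : Type) [CommRing A] [IsNoetherianRing A]
    (M : Type) [AddCommGroup M] [Module (Polynomial A) M] [Module A M]
    [IsScalarTower A (Polynomial A) M] [Module.Finite (Polynomial A) M]
    (r : ℕ → ℕ) (hr : Tendsto r atTop atTop)
    (w : ℕ → Module.End (Polynomial A) M)
    (hw : ∀ j (m : M), (w j ^ r j) m = (Polynomial.X : Polynomial A) • m) :
    Module.Finite A M := by
  obtain ⟨f, hf, hfm⟩ := exists_monic_mem_of_forall_isPrime (Module.annihilator (Polynomial A) M)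
    fun Q _ hQ ↦ exists_monic_mem_of_annihilator_le hr hw Q hQ
  exact Module.finite_of_monic_mem_annihilator hfm hf
end

section
/- Let M be a finitely generated module over A = ℤ[t₁^{±1},...,t_n^{±1}]. Suppose for every 1 ≤ i ≤ n there exists a sequence of integers r_{i,j} → ∞ and A-module automorphisms w_{i,j} : M → M such that w_{i,j}^{r_{i,j}} equals multiplication by t_i. Then M is finitely generated as a ℤ-module. -/
open Filter

/-- An element of the fraction field of a Dedekind domain which admits roots of arbitrarily large
order is integral. -/
theorem IsDedekindDomain.isIntegral_of_forall_exists_pow_eq {R K : Type*} [CommRing R]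
    [IsDedekindDomain R] [Field K] [Algebra R K] [IsFractionRing R K] {u : K}
    (h : ∀ N : ℕ, ∃ r ≥ N, ∃ v : K, v ^ r = u) : IsIntegral R u := by
  suffices u ∈ (algebraMap R K).range by
    obtain ⟨x, rfl⟩ := this
    exact isIntegral_algebraMap
  refine HeightOneSpectrum.mem_integers_of_valuation_le_one K u fun p ↦ ?_
  by_contra! hu
  obtain ⟨r, hr, v, rfl⟩ := h ((WithZero.log (p.valuation K u)).toNat + 1)
  have h0 : p.valuation K v ≠ 0 := by
    intro h0
    rw [map_pow, h0, zero_pow (by omega)] at hu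
    exact absurd hu (by simp)
  rw [map_pow] at hu hr
  have h1 : 1 < p.valuation K v := by
    by_contra! h1
    exact hu.not_ge (pow_le_one' h1 r)
  have h2 : 0 < WithZero.log (p.valuation K v) := by
    rwa [← WithZero.log_one, WithZero.log_lt_log one_ne_zero h0]
  rw [WithZero.log_pow, nsmul_eq_mul] at hr
  have : (r : ℤ) ≤ r * WithZero.log (p.valuation K v) := by nlinarith
  omega

open scoped IntermediateField.algebraAdjoinAdjoin in
/-- The algebraic closure of the base field in a finitely generated field extension is a finite
extension. -/
theorem algebraicClosure.finite_of_essFiniteType (F K : Type*) [Field F] [Field K] [Algebra F K]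
    [Algebra.EssFiniteType F K] : Module.Finite F (algebraicClosure F K) := by
  obtain ⟨s, hs⟩ := exists_isTranscendenceBasis F K
  have hsE : AlgebraicIndependent (algebraicClosure F K) ((↑) : s → K) := hs.1.extendScalars _
  let L := IntermediateField.adjoin F s
  have : Algebra.EssFiniteType L K := .of_comp F _ _
  have : Algebra.IsAlgebraic L K := by
    have := hs.isAlgebraic_field
    rwa [Subtype.range_coe] at this
  have : Module.Finite L K := Algebra.finite_of_essFiniteType_of_isAlgebraic
  let b := Module.Basis.ofVectorSpace F (algebraicClosure F K)
  suffices H : LinearIndependent (Algebra.adjoin F s) fun i ↦ (b i : K) by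
    have H' : LinearIndependent L fun i ↦ (b i : K) := (LinearIndependent.iff_fractionRing _ _).1 H
    have := H'.finite
    exact Module.Finite.of_basis b
  rw [linearIndependent_iff']
  intro t g hg i hi
  have hP (i) : ∃ P : MvPolynomial s F, MvPolynomial.aeval ((↑) : s → K) P = (g i : K) := by
    have := Algebra.adjoin_range_eq_range_aeval F ((↑) : s → K)
    rw [Subtype.range_coe] at this
    exact this.le (g i).2
  choose P hP using hP
  have h0 : ∑ i ∈ t, MvPolynomial.C (b i) *
      MvPolynomial.map (algebraMap F (algebraicClosure F K)) (P i) = 0 := by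
    refine hsE.eq_zero_of_aeval_eq_zero _ ?_
    rw [← hg, map_sum]
    refine Finset.sum_congr rfl fun i _ ↦ ?_
    rw [map_mul, MvPolynomial.aeval_C, MvPolynomial.aeval_map_algebraMap, hP,
      Algebra.smul_def, mul_comm]
    rfl
  have hPi : P i = 0 := by
    ext m
    refine linearIndependent_iff'.1 b.linearIndependent t (fun i ↦ (P i).coeff m) ?_ i hi
    rw [← MvPolynomial.coeff_zero (R := algebraicClosure F K) m, ← h0, MvPolynomial.coeff_sum]
    refine Finset.sum_congr rfl fun i _ ↦ ?_
    rw [MvPolynomial.coeff_C_mul, MvPolynomial.coeff_map, Algebra.smul_def, mul_comm]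
  ext
  rw [← hP, hPi, map_zero]
  rfl

/-- If `u` is transcendental over `L`, the order of a root of `u` in a finite extension of `L(u)`
divides the degree of that extension. -/
theorem Transcendental.dvd_finrank_of_pow_eq {L K : Type*} [Field L] [Field K] [Algebra L K]
    {u v : K} (hu : Transcendental L u)
    [FiniteDimensional (IntermediateField.adjoin L {u}) K] {r : ℕ}
    (h : v ^ r = u) : r ∣ Module.finrank (IntermediateField.adjoin L {u}) K := by
  let E := IntermediateField.adjoin L {u}
  let u' : E := IntermediateField.AdjoinSimple.gen L u
  have hN : (Algebra.norm E v) ^ r = u' ^ Module.finrank E K := by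
    rw [← map_pow, h, ← Algebra.norm_algebraMap]
    rfl
  obtain ⟨f, g, hfg⟩ := (IntermediateField.mem_adjoin_simple_iff L _).1 (Algebra.norm E v).2
  have hN' := congrArg (algebraMap E K) hN
  have hu0 : u ≠ 0 := by
    rintro rfl
    exact hu isAlgebraic_zero
  simp only [map_pow] at hN'
  change ((Algebra.norm E v : E) : K) ^ r = u ^ Module.finrank E K at hN'
  have hr : r ≠ 0 := by
    rintro rfl
    rw [pow_zero] at h
    exact hu (h ▸ isAlgebraic_one)
  have hg0 : Polynomial.aeval u g ≠ 0 := by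
    intro h0
    rw [hfg, h0, div_zero, zero_pow hr] at hN'
    exact pow_ne_zero _ hu0 hN'.symm
  have hg : g ≠ 0 := by
    rintro rfl
    simp at hg0
  rw [hfg, div_pow, div_eq_iff (pow_ne_zero _ hg0)] at hN'
  have hp : f ^ r = Polynomial.X ^ Module.finrank E K * g ^ r := by
    refine transcendental_iff_injective.1 hu ?_
    simpa using hN'
  have hd := congrArg Polynomial.natDegree hp
  rw [Polynomial.natDegree_mul (by simp) (pow_ne_zero _ hg), Polynomial.natDegree_pow,
    Polynomial.natDegree_pow, Polynomial.natDegree_pow, Polynomial.natDegree_X, mul_one] at hd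
  rw [← Nat.dvd_add_left (dvd_mul_right r g.natDegree), ← hd]
  exact dvd_mul_right _ _

/-- In a finitely generated field extension, an element which admits roots of arbitrarily large
order is algebraic. -/
theorem IsAlgebraic.of_forall_exists_pow_eq {F K : Type*} [Field F] [Field K] [Algebra F K]
    [Algebra.EssFiniteType F K] {u : K} (h : ∀ N : ℕ, ∃ r ≥ N, ∃ v : K, v ^ r = u) :
    IsAlgebraic F u := by
  by_contra hu
  have hind : AlgebraicIndepOn F id ({u} : Set K) :=
    (algebraicIndependent_singleton_iff (⟨u, rfl⟩ : ({u} : Set K))).2 hu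
  obtain ⟨t, hut, ht⟩ := exists_isTranscendenceBasis_superset hind
  rw [Set.singleton_subset_iff] at hut
  let L := IntermediateField.adjoin F (t \ {u})
  have huL : Transcendental L u := by
    rw [IntermediateField.transcendental_adjoin_iff]
    have := ht.1.transcendental_adjoin (s := {⟨u, hut⟩}ᶜ) (i := ⟨u, hut⟩) (by simp)
    have hst : ((↑) : t → K) '' {⟨u, hut⟩}ᶜ = t \ {u} := by
      ext
      simp [and_comm]
    rwa [hst] at this
  let E := IntermediateField.adjoin L {u}
  have : Algebra.EssFiniteType L K := .of_comp F _ _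
  have : Algebra.EssFiniteType E K := .of_comp L _ _
  have : Algebra.IsAlgebraic E K := by
    have := ht.isAlgebraic_field
    rw [Subtype.range_coe, ← Set.sdiff_union_of_subset (Set.singleton_subset_iff.2 hut),
      ← IntermediateField.adjoin_adjoin_left] at this
    exact this
  have : Module.Finite E K := Algebra.finite_of_essFiniteType_of_isAlgebraic
  obtain ⟨r, hr, v, hv⟩ := h (Module.finrank E K + 1)
  have : r ≤ Module.finrank E K := Nat.le_of_dvd Module.finrank_pos (huL.dvd_finrank_of_pow_eq hv)
  omega

/-- In a finitely generated field, an element which admits roots of arbitrarily large order is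
integral over `ℤ`. -/
theorem IsIntegral.int_of_forall_exists_pow_eq {K : Type*} [Field K] [hK : Algebra ℤ K]
    [Algebra.EssFiniteType ℤ K] {u : K} (h : ∀ N : ℕ, ∃ r ≥ N, ∃ v : K, v ^ r = u) :
    IsIntegral ℤ u := by
  obtain rfl : hK = Ring.toIntAlgebra K := Subsingleton.elim _ _
  obtain ⟨p, hp⟩ := CharP.exists K
  rcases CharP.char_is_prime_or_zero K p with hprime | rfl
  · have : Fact p.Prime := ⟨hprime⟩
    let _ := ZMod.algebra K p
    have : Algebra.EssFiniteType (ZMod p) K := .of_comp ℤ _ _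
    have : Algebra.IsIntegral ℤ (ZMod p) :=
      Algebra.isIntegral_of_surjective ZMod.intCast_surjective
    exact isIntegral_trans (A := ZMod p) u (IsAlgebraic.of_forall_exists_pow_eq h).isIntegral
  · have := CharP.charP_to_charZero K
    have : Algebra.EssFiniteType ℚ K := .of_comp ℤ _ _
    let k := algebraicClosure ℚ K
    have : Module.Finite ℚ k := algebraicClosure.finite_of_essFiniteType ℚ K
    have : NumberField k := { }
    have hu : IsAlgebraic ℚ u := .of_forall_exists_pow_eq h
    have hint : IsIntegral (NumberField.RingOfIntegers k)
        (⟨u, mem_algebraicClosure_iff.2 hu⟩ : k) := by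
      refine IsDedekindDomain.isIntegral_of_forall_exists_pow_eq fun N ↦ ?_
      obtain ⟨r, hr, v, hv⟩ := h (N + 1)
      refine ⟨r, by omega, ⟨v, mem_algebraicClosure_iff.2 (.of_pow (n := r) (by omega) ?_)⟩, ?_⟩
      · rwa [hv]
      · exact Subtype.ext hv
    exact (isIntegral_trans (R := ℤ) _ hint).map (k.val.restrictScalars ℤ)

open TensorProduct in
/-- If multiplication by `a` on a finite module over a finitely generated ring admits roots of
arbitrarily large order, then `a` is integral over `ℤ` at every point of the support. -/
theorem Module.isIntegral_algebraMap_residueField {A M : Type*} [CommRing A]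
    [Algebra ℤ A] [Algebra.FiniteType ℤ A] [AddCommGroup M] [Module A M] [Module.Finite A M] {a : A}
    (h : ∀ N : ℕ, ∃ r ≥ N, ∃ w : Module.End A M, w ^ r = algebraMap A (Module.End A M) a)
    {p : PrimeSpectrum A} (hp : p ∈ Module.support A M) :
    IsIntegral ℤ (algebraMap A p.asIdeal.ResidueField a) := by
  let K := p.asIdeal.ResidueField
  have : Nontrivial (K ⊗[A] M) :=
    (Module.mem_support_iff_nontrivial_residueField_tensorProduct p).1 hp
  have : Algebra.EssFiniteType ℤ K := .comp ℤ A K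
  have hd : 0 < Module.finrank K (K ⊗[A] M) := Module.finrank_pos
  refine IsIntegral.of_pow hd (IsIntegral.int_of_forall_exists_pow_eq fun N ↦ ?_)
  obtain ⟨r, hr, w, hw⟩ := h N
  refine ⟨r, hr, LinearMap.det (w.baseChange K), ?_⟩
  have hw' : (w ^ r).baseChange K = algebraMap A K a • LinearMap.id := by
    rw [hw]
    ext m
    simp [TensorProduct.tmul_smul, TensorProduct.smul_tmul', Algebra.smul_def]
  rw [← map_pow, ← LinearMap.baseChange_pow, hw', LinearMap.det_smul, LinearMap.det_id, mul_one]

/-- Integrality modulo an ideal can be tested at the points of its zero locus. -/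
theorem Ideal.Quotient.isIntegral_mk_of_forall_residueField {R A : Type*} [CommRing R] [CommRing A]
    [Algebra R A] {I : Ideal A} {a : A}
    (h : ∀ p : PrimeSpectrum A, I ≤ p.asIdeal →
      IsIntegral R (algebraMap A p.asIdeal.ResidueField a)) :
    IsIntegral R (Ideal.Quotient.mk I a) := by
  let S : Submonoid A :=
    { carrier := {x | ∃ f : Polynomial R, f.Monic ∧ Polynomial.aeval a f = x}
      one_mem' := ⟨1, Polynomial.monic_one, map_one _⟩
      mul_mem' := by
        rintro _ _ ⟨f, hf, rfl⟩ ⟨g, hg, rfl⟩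
        exact ⟨f * g, hf.mul hg, map_mul _ _ _⟩ }
  by_cases hS : Disjoint (I : Set A) S
  · obtain ⟨p, hp, hIp, hpS⟩ := Ideal.exists_le_prime_disjoint I S hS
    obtain ⟨f, hf, hfa⟩ := h ⟨p, hp⟩ hIp
    refine absurd (⟨f, hf, rfl⟩ : Polynomial.aeval a f ∈ S) (Set.disjoint_left.1 hpS ?_)
    rw [← Polynomial.aeval_def, Polynomial.aeval_algebraMap_apply] at hfa
    exact Ideal.algebraMap_residueField_eq_zero.1 hfa
  · obtain ⟨_, hI, ⟨f, hf, rfl⟩⟩ := Set.not_disjoint_iff.1 hS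
    refine ⟨f, hf, ?_⟩
    rw [← Polynomial.aeval_def]
    change Polynomial.aeval (Ideal.Quotient.mkₐ R I a) f = 0
    rw [Polynomial.aeval_algHom_apply]
    exact Ideal.Quotient.eq_zero_iff_mem.2 hI

/-- If multiplication by `a` on a finite module over a finitely generated ring admits roots of
arbitrarily large order, then `a` is integral over `ℤ` modulo the annihilator. -/
theorem Module.isIntegral_mk_annihilator {A M : Type*} [CommRing A]
    [Algebra ℤ A] [Algebra.FiniteType ℤ A] [AddCommGroup M] [Module A M] [Module.Finite A M] {a : A}
    (h : ∀ N : ℕ, ∃ r ≥ N, ∃ w : Module.End A M, w ^ r = algebraMap A (Module.End A M) a) :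
    IsIntegral ℤ (Ideal.Quotient.mk (Module.annihilator A M) a) := by
  refine Ideal.Quotient.isIntegral_mk_of_forall_residueField fun p hp ↦ ?_
  refine Module.isIntegral_algebraMap_residueField h ?_
  rw [Module.support_eq_zeroLocus]
  exact hp

/-- A finite module over a finitely generated ring which is integral over `ℤ` modulo the
annihilator of the module is finite over `ℤ`. -/
theorem Module.Finite.int_of_isIntegral_quotient_annihilator {A M : Type*} [CommRing A]
    [Algebra ℤ A] [Algebra.FiniteType ℤ A] [AddCommGroup M] [Module A M] [Module.Finite A M]
    [Algebra.IsIntegral ℤ (A ⧸ Module.annihilator A M)] : Module.Finite ℤ M := by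
  let B := A ⧸ Module.annihilator A M
  have : Algebra.FiniteType ℤ B :=
    .of_surjective (Ideal.Quotient.mkₐ ℤ _) (Ideal.Quotient.mkₐ_surjective ℤ _)
  have : Module.Finite ℤ B := by
    convert! Algebra.IsIntegral.finite (R := ℤ) (A := B)
    exact Subsingleton.elim _ _
  let _ : Module B M := Module.quotientAnnihilator
  have : Module.Finite B M := .of_restrictScalars_finite A B M
  exact .trans B M

/-- A quotient of a Laurent polynomial ring is integral over the base as soon as the variables and
their inverses are. -/
theorem AddMonoidAlgebra.isIntegral_quotient {R ι : Type*} [CommRing R] [Finite ι] [DecidableEq ι]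
    {I : Ideal (AddMonoidAlgebra R (ι → ℤ))}
    (hpos : ∀ i, IsIntegral R (Ideal.Quotient.mk I (single (Pi.single i 1) 1)))
    (hneg : ∀ i, IsIntegral R (Ideal.Quotient.mk I (single (-Pi.single i 1) 1))) :
    Algebra.IsIntegral R (AddMonoidAlgebra R (ι → ℤ) ⧸ I) := by
  cases nonempty_fintype ι
  let P : AddSubmonoid (ι → ℤ) :=
    { carrier := {x | IsIntegral R (Ideal.Quotient.mk I (single x 1))}
      zero_mem' := by
        simpa only [Set.mem_ofPred_eq, ← one_def, map_one] using isIntegral_one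
      add_mem' := fun {x y} hx hy ↦ by
        have : (single (x + y) 1 : AddMonoidAlgebra R (ι → ℤ)) = single x 1 * single y 1 := by
          rw [single_mul_single, one_mul]
        simpa only [Set.mem_ofPred_eq, this, map_mul] using IsIntegral.mul hx hy }
  have hP (x : ι → ℤ) : x ∈ P := by
    rw [← Finset.univ_sum_single x]
    refine sum_mem fun i _ ↦ ?_
    obtain ⟨k, hk | hk⟩ := (x i).eq_nat_or_neg
    · have : (Pi.single i (x i) : ι → ℤ) = k • Pi.single i 1 := by
        rw [← Pi.single_smul, hk, nsmul_one]
      exact this ▸ nsmul_mem (hpos i) k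
    · have : (Pi.single i (x i) : ι → ℤ) = k • -Pi.single i 1 := by
        rw [smul_neg, ← Pi.single_smul, hk, nsmul_one, Pi.single_neg]
      exact this ▸ nsmul_mem (hneg i) k
  refine ⟨fun b ↦ ?_⟩
  obtain ⟨a, rfl⟩ := Ideal.Quotient.mk_surjective b
  induction a using AddMonoidAlgebra.induction_on with
  | of x => exact hP _
  | add f g hf hg => simpa only [map_add] using hf.add hg
  | smul c f hf => exact hf.smul c

/-- Let `M` be a finitely generated module over the Laurent polynomial ring
`A = ℤ[t₁^{±1},...,t_n^{±1}] = ℤ[ℤ^n]`.  Suppose for every `i` there is a sequence of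
integers `r i j → ∞` and `A`-module automorphisms `w i j : M → M` with `(w i j)^(r i j)`
equal to multiplication by `t_i`.  Then `M` is finitely generated as a `ℤ`-module. -/
theorem stmt1 (n : ℕ) (M : Type) [AddCommGroup M]
    [Module (AddMonoidAlgebra ℤ (Fin n → ℤ)) M]
    [Module.Finite (AddMonoidAlgebra ℤ (Fin n → ℤ)) M]
    (r : Fin n → ℕ → ℕ) (hr : ∀ i, Tendsto (r i) atTop atTop)
    (w : Fin n → ℕ → (M ≃ₗ[AddMonoidAlgebra ℤ (Fin n → ℤ)] M))
    (hw : ∀ i j (m : M), (w i j ^ r i j) m =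
      (AddMonoidAlgebra.single (Pi.single i (1 : ℤ) : Fin n → ℤ) (1 : ℤ)) • m) :
    Module.Finite ℤ M := by
  have hcoe (e : M ≃ₗ[AddMonoidAlgebra ℤ (Fin n → ℤ)] M) (k : ℕ) :
      (e : Module.End (AddMonoidAlgebra ℤ (Fin n → ℤ)) M) ^ k = ↑(e ^ k) :=
    (map_pow (LinearEquiv.automorphismGroup.toLinearMapMonoidHom) e k).symm
  have : AddMonoid.FG (Fin n → ℤ) :=
    AddGroup.fg_iff_addMonoid_fg.1 (Module.Finite.iff_addGroup_fg.1 inferInstance)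
  have : Algebra.FiniteType ℤ (AddMonoidAlgebra ℤ (Fin n → ℤ)) :=
    AddMonoidAlgebra.finiteType_of_fg ℤ (Fin n → ℤ)
  have : Algebra.IsIntegral ℤ (AddMonoidAlgebra ℤ (Fin n → ℤ) ⧸
      Module.annihilator (AddMonoidAlgebra ℤ (Fin n → ℤ)) M) := by
    refine AddMonoidAlgebra.isIntegral_quotient (fun i ↦ ?_) (fun i ↦ ?_) <;>
      refine Module.isIntegral_mk_annihilator fun N ↦ ?_ <;>
      obtain ⟨j, hj⟩ := ((hr i).eventually_ge_atTop N).exists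
    · refine ⟨r i j, hj, w i j, ?_⟩
      rw [hcoe]
      exact LinearMap.ext (hw i j)
    · refine ⟨r i j, hj, ↑(w i j)⁻¹, ?_⟩
      rw [hcoe, inv_pow]
      ext m
      refine (w i j ^ r i j).symm_apply_eq.2 ?_
      rw [hw, Module.algebraMap_end_apply, smul_smul, AddMonoidAlgebra.single_mul_single,
        add_neg_cancel, one_mul, ← AddMonoidAlgebra.one_def, one_smul]
  exact Module.Finite.int_of_isIntegral_quotient_annihilator (A := AddMonoidAlgebra ℤ (Fin n → ℤ))
end

section
/- Let X be a closed topological manifold and suppose X supports an effective action of a torus T^m with m = dim X. Then X is homeomorphic to T^m. -/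
section TorusAction
open Set Filter Topology MeasureTheory Metric

section Brouwer
variable {E : Type*} [NormedAddCommGroup E] [InnerProductSpace ℝ E] [FiniteDimensional ℝ E]

/-- `t ↦ det (1 + t A)` is a polynomial of degree at most `dim E`. -/
lemma exists_polynomial_det_one_add_smul (A : E →L[ℝ] E) :
    ∃ q : Polynomial ℝ, q.natDegree ≤ Module.finrank ℝ E ∧
      ∀ t : ℝ, q.eval t = (ContinuousLinearMap.id ℝ E + t • A).det := by
  let b := Module.finBasis ℝ E
  let M := LinearMap.toMatrix b b (A : E →ₗ[ℝ] E)
  refine ⟨Matrix.det ((Polynomial.X : Polynomial ℝ) • M.map Polynomial.C +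
    (1 : Matrix _ _ ℝ).map Polynomial.C), ?_, fun t => ?_⟩
  · simpa using Polynomial.natDegree_det_X_add_C_le M 1
  · rw [← Polynomial.coe_evalRingHom, RingHom.map_det, ContinuousLinearMap.det,
      ← LinearMap.det_toMatrix b]
    congr 1
    have : ((ContinuousLinearMap.id ℝ E + t • A : E →L[ℝ] E) : E →ₗ[ℝ] E)
      = LinearMap.id + t • (A : E →ₗ[ℝ] E) := rfl
    have hM : LinearMap.toMatrix b b (LinearMap.id + t • (A : E →ₗ[ℝ] E)) = 1 + t • M := by
      rw [map_add, map_smul, LinearMap.toMatrix_id]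
    rw [this, hM]
    ext i j
    simp [Matrix.one_apply, apply_ite (Polynomial.eval t)]
    ring

lemma lipschitzWith_radial_retraction {E : Type*} [NormedAddCommGroup E] [InnerProductSpace ℝ E] :
    LipschitzWith 2 (fun x : E => (max 1 ‖x‖)⁻¹ • x) := by
  refine LipschitzWith.of_dist_le_mul fun x y => ?_
  set a := max 1 ‖x‖
  set b := max 1 ‖y‖
  have ha : 1 ≤ a := le_max_left _ _
  have hb : 1 ≤ b := le_max_left _ _
  have hyb : ‖y‖ ≤ b := le_max_right _ _
  have hab : |b - a| ≤ ‖x - y‖ := by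
    have h1 : |b - a| ≤ |‖y‖ - ‖x‖| := by
      simpa [a, b] using abs_max_sub_max_le_max 1 ‖y‖ 1 ‖x‖
    exact h1.trans (by rw [norm_sub_rev]; exact abs_norm_sub_norm_le y x)
  have key : a⁻¹ • x - b⁻¹ • y = a⁻¹ • (x - y) + ((b - a) * a⁻¹ * b⁻¹) • y := by
    have : (b - a) * a⁻¹ * b⁻¹ = a⁻¹ - b⁻¹ := by field_simp
    rw [this, smul_sub, sub_smul]; abel
  rw [dist_eq_norm, key, dist_eq_norm]
  have h2 : ‖a⁻¹ • (x - y)‖ ≤ ‖x - y‖ := by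
    rw [norm_smul, Real.norm_of_nonneg (by positivity)]
    exact mul_le_of_le_one_left (norm_nonneg _) (inv_le_one_of_one_le₀ ha)
  have h3 : ‖((b - a) * a⁻¹ * b⁻¹) • y‖ ≤ ‖x - y‖ := by
    rw [norm_smul, norm_mul, norm_mul, Real.norm_eq_abs,
      Real.norm_of_nonneg (by positivity : 0 ≤ a⁻¹),
      Real.norm_of_nonneg (by positivity : 0 ≤ b⁻¹)]
    calc |b - a| * a⁻¹ * b⁻¹ * ‖y‖ = (|b - a| * a⁻¹) * (b⁻¹ * ‖y‖) := by ring
      _ ≤ (|b - a| * 1) * 1 := by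
        gcongr
        · exact inv_le_one_of_one_le₀ ha
        · rw [inv_mul_le_iff₀ (by positivity)]; linarith
      _ ≤ _ := by linarith
  calc _ ≤ _ := norm_add_le _ _
    _ ≤ _ := by push_cast; linarith

lemma LipschitzWith.bijective_id_add {K : NNReal} {k : E → E} (hk : LipschitzWith K k)
    (hK : K < 1) : Function.Bijective (fun x => x + k x) := by
  constructor
  · intro x y hxy
    have h1 : dist x y = dist (k x) (k y) := by
      have : x - y = -(k x - k y) := by
        have : x + k x = y + k y := hxy
        rw [eq_neg_iff_add_eq_zero]
        rw [← sub_eq_zero] at this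
        rw [← this]; abel
      rw [dist_eq_norm, this, norm_neg, dist_eq_norm]
    have h2 := hk.dist_le_mul x y
    by_contra hne
    have h3 := dist_pos.2 hne
    have : (K : ℝ) < 1 := hK
    nlinarith
  · intro y
    have hc : ContractingWith K (fun x => y - k x) := by
      refine ⟨hK, LipschitzWith.of_dist_le_mul fun a b => ?_⟩
      rw [dist_sub_left]
      exact hk.dist_le_mul a b
    refine ⟨hc.fixedPoint, ?_⟩
    have := hc.fixedPoint_isFixedPt
    have h : y - k hc.fixedPoint = hc.fixedPoint := this
    change hc.fixedPoint + k hc.fixedPoint = y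
    nth_rw 1 [← h]; abel

/-- There is no `C¹` retraction of the closed unit ball onto the unit sphere. -/
theorem no_contDiff_retraction {r : E → E} (hr : ContDiffOn ℝ 1 r (closedBall 0 1))
    (hr' : ∀ x ∈ closedBall (0 : E) 1, DifferentiableAt ℝ r x)
    (hn : ∀ x ∈ closedBall (0 : E) 1, ‖r x‖ = 1) (hs : ∀ x ∈ sphere (0 : E) 1, r x = x) :
    False := by
  let _ : MeasurableSpace E := borel E
  have _ : BorelSpace E := ⟨rfl⟩
  let μ : Measure E := volume
  obtain ⟨C, hC⟩ : ∃ C, LipschitzOnWith C r (closedBall 0 1) := by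
    refine (LocallyLipschitzOn.exists_lipschitzOnWith_of_compact (isCompact_closedBall 0 1) ?_)
    exact hr.locallyLipschitzOn (convex_closedBall 0 1)
  let P : E → E := fun x => (max 1 ‖x‖)⁻¹ • x
  have hP : LipschitzWith 2 P := lipschitzWith_radial_retraction
  have hPmem : ∀ x, P x ∈ closedBall (0 : E) 1 := fun x => by
    simp only [P, mem_closedBall_zero_iff, norm_smul, norm_inv]
    rw [Real.norm_of_nonneg (by positivity), inv_mul_le_iff₀ (by positivity)]
    simp
  have hPid : ∀ x ∈ closedBall (0 : E) 1, P x = x := fun x hx => by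
    have : max 1 ‖x‖ = 1 := max_eq_left (by simpa using hx)
    simp [P, this]
  have hPs : ∀ x ∉ ball (0 : E) 1, P x ∈ sphere (0 : E) 1 := fun x hx => by
    have h1 : 1 ≤ ‖x‖ := by simpa using hx
    have : max 1 ‖x‖ = ‖x‖ := max_eq_right h1
    simp only [P, this, mem_sphere_zero_iff_norm, norm_smul, norm_inv, norm_norm]
    field_simp
  let k : E → E := fun x => r (P x) - P x
  have hk0 : ∀ x ∉ ball (0 : E) 1, k x = 0 := fun x hx => by simp [k, hs _ (hPs x hx)]
  have hkL : LipschitzWith (C * 2 + 2) k := by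
    refine LipschitzWith.sub ?_ hP
    refine LipschitzWith.of_dist_le_mul fun x y => ?_
    have h1 := hC.dist_le_mul _ (hPmem x) _ (hPmem y)
    have h2 := hP.dist_le_mul x y
    push_cast at h2 ⊢
    calc _ ≤ _ := h1
      _ ≤ C * (2 * dist x y) := by gcongr
      _ = _ := by ring
  let B := ball (0 : E) 1
  have hBm : MeasurableSet B := measurableSet_ball
  let A : E → E →L[ℝ] E := fun x => fderiv ℝ r x - ContinuousLinearMap.id ℝ E
  have hkd : ∀ x ∈ B, HasFDerivAt k (A x) x := fun x hx => by
    have h1 : HasFDerivAt (fun x => r x - x) (A x) x :=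
      (hr' x (ball_subset_closedBall hx)).hasFDerivAt.sub (hasFDerivAt_id x)
    refine h1.congr_of_eventuallyEq ?_
    filter_upwards [isOpen_ball.mem_nhds hx] with y hy
    simp [k, hPid y (ball_subset_closedBall hy)]
  -- a bound on the derivative of `k`
  have hAb : ∀ x ∈ B, ‖A x‖ ≤ (C * 2 + 2 : NNReal) := fun x hx =>
    (hkd x hx).le_of_lipschitz hkL
  obtain ⟨δ, hδ, hdet⟩ : ∃ δ > 0, ∀ T : E →L[ℝ] E, ‖T‖ < δ →
      0 < (ContinuousLinearMap.id ℝ E + T).det := by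
    have hcont : ContinuousAt
        (fun T : E →L[ℝ] E => (ContinuousLinearMap.id ℝ E + T).det) 0 :=
      (ContinuousLinearMap.continuous_det.comp (continuous_const.add continuous_id)).continuousAt
    have h1 : ∀ᶠ T in 𝓝 (0 : E →L[ℝ] E), 0 < (ContinuousLinearMap.id ℝ E + T).det := by
      refine hcont.eventually_const_lt ?_
      simp [ContinuousLinearMap.det]
    obtain ⟨δ, hδ, h⟩ := Metric.eventually_nhds_iff.1 h1
    exact ⟨δ, hδ, fun T hT => h (by simpa using hT)⟩
  obtain ⟨t₀, ht₀, ht₀δ, ht₀1⟩ : ∃ t₀ : ℝ, 0 < t₀ ∧ t₀ * (C * 2 + 2) < δ ∧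
      t₀ * (C * 2 + 2) < 1 := by
    have hC0 : (0 : ℝ) < C * 2 + 2 := by positivity
    refine ⟨min δ 1 / 2 / (C * 2 + 2), by positivity, ?_, ?_⟩
    · rw [div_mul_cancel₀ _ hC0.ne']
      have := min_le_left δ 1
      linarith
    · rw [div_mul_cancel₀ _ hC0.ne']
      have := min_le_right δ 1
      linarith
  -- for small `t` the integral of the Jacobian is the volume of the ball
  have hsmall : ∀ t ∈ Ioc 0 t₀,
      IntegrableOn (fun x => (ContinuousLinearMap.id ℝ E + t • A x).det) B μ ∧
      ∫ x in B, (ContinuousLinearMap.id ℝ E + t • A x).det ∂μ = μ.real B := by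
    intro t ht
    let f : E → E := fun x => x + t • k x
    have htk : t * (C * 2 + 2) ≤ t₀ * (C * 2 + 2) := by gcongr; exact ht.2
    have hfb : Function.Bijective f := by
      have h1 : LipschitzWith (t.toNNReal * (C * 2 + 2)) (fun x => t • k x) := by
        refine LipschitzWith.of_dist_le_mul fun x y => ?_
        rw [dist_smul₀, Real.norm_of_nonneg ht.1.le, NNReal.coe_mul,
          Real.coe_toNNReal t ht.1.le, mul_assoc]
        exact mul_le_mul_of_nonneg_left (hkL.dist_le_mul x y) ht.1.le
      refine h1.bijective_id_add ?_
      rw [← NNReal.coe_lt_coe]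
      push_cast
      rw [Real.coe_toNNReal t ht.1.le]
      exact lt_of_le_of_lt htk ht₀1
    have hfid : ∀ x ∉ B, f x = x := fun x hx => by simp [f, hk0 x hx]
    have hfB : f '' B = B := by
      apply Subset.antisymm
      · rintro _ ⟨x, hx, rfl⟩
        by_contra hfx
        exact hfx (by rw [hfb.1 (hfid _ hfx)]; exact hx)
      · intro y hy
        obtain ⟨x, rfl⟩ := hfb.2 y
        refine ⟨x, ?_, rfl⟩
        by_contra hx
        rw [hfid x hx] at hy
        exact hx hy
    have hfd : ∀ x ∈ B, HasFDerivWithinAt f (ContinuousLinearMap.id ℝ E + t • A x) B x :=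
      fun x hx => ((hasFDerivAt_id x).add ((hkd x hx).const_smul t)).hasFDerivWithinAt
    have hpos : ∀ x ∈ B, |(ContinuousLinearMap.id ℝ E + t • A x).det| • (1 : ℝ) =
        (ContinuousLinearMap.id ℝ E + t • A x).det := fun x hx => by
      rw [smul_eq_mul, mul_one, abs_of_pos]
      apply hdet
      rw [norm_smul, Real.norm_of_nonneg ht.1.le]
      have := hAb x hx
      push_cast at this
      calc _ ≤ t * (C * 2 + 2) := by gcongr; exact ht.1.le
        _ < δ := lt_of_le_of_lt htk ht₀δ
    have hint := integrableOn_image_iff_integrableOn_abs_det_fderiv_smul μ hBm hfd hfb.1.injOn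
      (fun _ => (1 : ℝ))
    have hintg := integral_image_eq_integral_abs_det_fderiv_smul μ hBm hfd hfb.1.injOn
      (fun _ => (1 : ℝ))
    rw [hfB] at hint hintg
    rw [setIntegral_congr_fun hBm hpos] at hintg
    rw [integrableOn_congr_fun hpos hBm] at hint
    refine ⟨hint.1 ?_, ?_⟩
    · exact integrableOn_const measure_ball_lt_top.ne
    · rw [← hintg]; simp
  -- the Jacobian of `r` vanishes
  have hzero : ∀ x ∈ B, (ContinuousLinearMap.id ℝ E + (1 : ℝ) • A x).det = 0 := by
    intro x hx
    have hA : ContinuousLinearMap.id ℝ E + (1 : ℝ) • A x = fderiv ℝ r x := by simp [A]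
    rw [hA]
    by_contra hne
    have horth : ∀ v, inner ℝ (r x) (fderiv ℝ r x v) = 0 := by
      intro v
      have h1 : HasFDerivAt (fun y => inner ℝ (r y) (r y)) (0 : E →L[ℝ] ℝ) x := by
        refine (hasFDerivAt_const (1 : ℝ) x).congr_of_eventuallyEq ?_
        filter_upwards [isOpen_ball.mem_nhds hx] with y hy
        rw [real_inner_self_eq_norm_sq, hn y (ball_subset_closedBall hy)]; norm_num
      have hd := (hr' x (ball_subset_closedBall hx)).hasFDerivAt
      have h2 := hd.inner ℝ hd
      have h3 := congrArg (fun T : E →L[ℝ] ℝ => T v) (h1.unique h2)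
      simp only [zero_apply, ContinuousLinearMap.comp_apply,
        ContinuousLinearMap.prod_apply, fderivInnerCLM_apply] at h3
      have h4 := real_inner_comm (r x) (fderiv ℝ r x v)
      linarith
    have hsurj : Function.Surjective (fderiv ℝ r x) := by
      have := LinearMap.isUnit_iff_isUnit_det (fderiv ℝ r x : E →ₗ[ℝ] E)
      have hu := this.2 (isUnit_iff_ne_zero.2 hne)
      exact ((Module.End.isUnit_iff _).1 hu).2
    obtain ⟨v, hv⟩ := hsurj (r x)
    have h4 := horth v
    rw [hv, real_inner_self_eq_norm_sq, hn x (ball_subset_closedBall hx)] at h4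
    norm_num at h4
  -- interpolate
  choose q hqdeg hq using fun x => exists_polynomial_det_one_add_smul (A x)
  let N := Module.finrank ℝ E + 1
  let s : Finset ℕ := Finset.range N
  let v : ℕ → ℝ := fun i => t₀ / (i + 1)
  have hv : InjOn v s := by
    intro i _ j _ hij
    simp only [v] at hij
    rw [div_eq_div_iff (by positivity) (by positivity)] at hij
    have := mul_left_cancel₀ ht₀.ne' hij
    norm_cast at this
    omega
  have hvm : ∀ i, v i ∈ Ioc 0 t₀ := fun i =>
    ⟨by positivity, div_le_self ht₀.le (by simp)⟩
  let c : ℕ → ℝ := fun i => (Lagrange.basis s v i).eval 1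
  have hsne : s.Nonempty := by simp [s, N]
  have hc : ∑ i ∈ s, c i = 1 := by
    have := congrArg (Polynomial.eval (1 : ℝ)) (Lagrange.sum_basis hv hsne)
    simpa [Polynomial.eval_finsetSum, c] using this
  have hinterp : ∀ x, (ContinuousLinearMap.id ℝ E + (1 : ℝ) • A x).det =
      ∑ i ∈ s, c i * (ContinuousLinearMap.id ℝ E + v i • A x).det := by
    intro x
    have hd : (q x).degree < s.card := by
      refine lt_of_le_of_lt Polynomial.degree_le_natDegree ?_
      have := hqdeg x
      simp only [s, N, Finset.card_range]
      exact_mod_cast Nat.lt_succ_of_le this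
    have h := congrArg (Polynomial.eval (1 : ℝ)) (Lagrange.eq_interpolate hv hd)
    rw [Lagrange.interpolate_apply, Polynomial.eval_finsetSum] at h
    rw [← hq, h]
    refine Finset.sum_congr rfl fun i _ => ?_
    simp [hq, c, mul_comm]
  have hfin : ∫ x in B, (ContinuousLinearMap.id ℝ E + (1 : ℝ) • A x).det ∂μ = μ.real B := by
    simp_rw [hinterp]
    rw [integral_finsetSum _ fun i _ => ((hsmall _ (hvm i)).1.const_mul _)]
    simp_rw [integral_const_mul, (hsmall _ (hvm _)).2]
    rw [← Finset.sum_mul, hc, one_mul]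
  rw [setIntegral_congr_fun hBm hzero] at hfin
  have hB0 : 0 < μ B := measure_ball_pos μ 0 one_pos
  have : 0 < μ.real B := ENNReal.toReal_pos hB0.ne' measure_ball_lt_top.ne
  simp at hfin
  linarith
/-- **Brouwer fixed point theorem** for the closed unit ball. -/
theorem exists_fixedPoint_closedBall {F : E → E} (hF : Continuous F)
    (hm : MapsTo F (closedBall 0 1) (closedBall 0 1)) : ∃ x ∈ closedBall (0 : E) 1, F x = x := by
  by_contra! hne
  obtain ⟨x₀, hx₀, hmin⟩ := (isCompact_closedBall (0 : E) 1).exists_isMinOn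
    ⟨0, by simp⟩ (f := fun x => ‖F x - x‖) (by fun_prop)
  set η := ‖F x₀ - x₀‖
  have hη : 0 < η := norm_pos_iff.2 (sub_ne_zero.2 (hne x₀ hx₀))
  obtain ⟨F₁, hF₁, hF₁d, -⟩ := hF.exists_contDiff_approx 1 (ε := fun _ => η / 4)
    continuous_const (fun _ => by positivity)
  let ε := η / 4
  have hε : 0 < ε := by positivity
  let F₂ : E → E := fun x => (1 + ε)⁻¹ • F₁ x
  have hF₂ : ContDiff ℝ 1 F₂ := hF₁.const_smul _
  have hF₁n : ∀ x ∈ closedBall (0 : E) 1, ‖F₁ x‖ < 1 + ε := fun x hx => by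
    have h1 := hF₁d x
    have h2 : ‖F x‖ ≤ 1 := by simpa using hm hx
    rw [dist_eq_norm] at h1
    calc ‖F₁ x‖ = ‖F x + (F₁ x - F x)‖ := by congr 1; abel
      _ ≤ _ := norm_add_le _ _
      _ < _ := by simp only [ε]; linarith
  have hF₂n : ∀ x ∈ closedBall (0 : E) 1, ‖F₂ x‖ < 1 := fun x hx => by
    simp only [F₂, norm_smul, norm_inv]
    rw [Real.norm_of_nonneg (by positivity), inv_mul_lt_iff₀ (by positivity)]
    simpa using hF₁n x hx
  let u : E → E := fun x => x - F₂ x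
  have hu : ContDiff ℝ 1 u := contDiff_id.sub hF₂
  have hu0 : ∀ x ∈ closedBall (0 : E) 1, u x ≠ 0 := fun x hx h => by
    have h0 : F₂ x = x := (sub_eq_zero.1 h).symm
    have h1 : F₁ x = (1 + ε) • x := (inv_smul_eq_iff₀ (by positivity)).1 h0
    have h2 := hF₁d x
    rw [dist_eq_norm, h1] at h2
    have h3 : η ≤ ‖F x - x‖ := hmin hx
    have h4 : F x - x = ε • x - ((1 + ε) • x - F x) := by rw [add_smul, one_smul]; abel
    have h5 : ‖x‖ ≤ 1 := by simpa using hx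
    have h6 : ‖ε • x‖ ≤ ε := by
      rw [norm_smul, Real.norm_of_nonneg hε.le]; nlinarith
    have h7 := norm_sub_le (ε • x) ((1 + ε) • x - F x)
    rw [← h4] at h7
    simp only [ε] at h6 h7 h2
    linarith
  let D : E → ℝ := fun x => inner ℝ x (u x) ^ 2 + ‖u x‖ ^ 2 * (1 - ‖x‖ ^ 2)
  have hD : ContDiff ℝ 1 D := by
    have := hu.norm_sq ℝ
    have h2 := (contDiff_id (𝕜 := ℝ) (E := E) (n := 1)).norm_sq ℝ
    exact ((contDiff_id.inner ℝ hu).pow 2).add (this.mul (contDiff_const.sub h2))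
  have hpos : ∀ x ∈ sphere (0 : E) 1, 0 < inner ℝ x (u x) := fun x hx => by
    have h1 : ‖x‖ = 1 := by simpa using hx
    have h2 := real_inner_le_norm x (F₂ x)
    have h3 := hF₂n x (sphere_subset_closedBall hx)
    simp only [u]
    rw [inner_sub_right, real_inner_self_eq_norm_sq, h1]
    rw [h1] at h2
    linarith
  have hDpos : ∀ x ∈ closedBall (0 : E) 1, 0 < D x := fun x hx => by
    have hu2 : 0 < ‖u x‖ ^ 2 := by have := norm_pos_iff.2 (hu0 x hx); positivity
    have h5 : ‖x‖ ≤ 1 := by simpa using hx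
    rcases h5.lt_or_eq with h | h
    · have : 0 < 1 - ‖x‖ ^ 2 := by nlinarith [norm_nonneg x]
      positivity
    · have := hpos x (by simpa using h)
      simp only [D, h]
      norm_num
      positivity
  let r : E → E := fun x => x + ((-inner ℝ x (u x) + √(D x)) / ‖u x‖ ^ 2) • u x
  have hr : ∀ x ∈ closedBall (0 : E) 1, ContDiffAt ℝ 1 r x := fun x hx => by
    refine contDiffAt_id.add (ContDiffAt.smul (ContDiffAt.div ?_ ?_ ?_) hu.contDiffAt)
    · exact ((contDiff_id.inner ℝ hu).neg.contDiffAt).add (hD.contDiffAt.sqrt (hDpos x hx).ne')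
    · exact (hu.norm_sq ℝ).contDiffAt
    · have := norm_pos_iff.2 (hu0 x hx); positivity
  refine no_contDiff_retraction (r := r) (fun x hx => (hr x hx).contDiffWithinAt)
    (fun x hx => (hr x hx).differentiableAt one_ne_zero) (fun x hx => ?_) (fun x hx => ?_)
  · have hu2 : 0 < ‖u x‖ ^ 2 := by have := norm_pos_iff.2 (hu0 x hx); positivity
    have h1 : ‖r x‖ ^ 2 = 1 := by
      simp only [r]
      rw [norm_add_sq_real, inner_smul_right, norm_smul, mul_pow, Real.norm_eq_abs, sq_abs]
      have h2 := Real.sq_sqrt (hDpos x hx).le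
      set w := √(D x)
      simp only [D] at h2
      set U := ‖u x‖ ^ 2
      set q : ℝ := inner ℝ x (u x)
      have h3 := hu2.ne'
      have h4 : (-q + w) / U * q * 2 * U + ((-q + w) / U) ^ 2 * U * U = w ^ 2 - q ^ 2 := by
        field_simp
        ring
      have h5 : U * (‖x‖ ^ 2 + 2 * ((-q + w) / U * q) + ((-q + w) / U) ^ 2 * U) = U * 1 := by
        linear_combination h4 + h2
      exact mul_left_cancel₀ h3 h5
    have := norm_nonneg (r x)
    nlinarith
  · have h1 : ‖x‖ = 1 := by simpa using hx
    have h2 : √(D x) = inner ℝ x (u x) := by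
      simp only [D, h1]
      norm_num
      exact Real.sqrt_sq (hpos x hx).le
    simp [r, h2]

/-- A nowhere vanishing vector field on a closed ball points straight inwards somewhere on the
boundary. -/
theorem exists_sphere_eq_neg_smul {g : E → E} {R : ℝ} (hR : 0 < R)
    (hg : ContinuousOn g (closedBall 0 R)) (h0 : ∀ x ∈ closedBall 0 R, g x ≠ 0) :
    ∃ v ∈ sphere (0 : E) R, ∃ c : ℝ, 0 < c ∧ g v = -(c • v) := by
  let P : E → E := fun x => (max 1 ‖x‖)⁻¹ • x
  have hP : Continuous P := lipschitzWith_radial_retraction.continuous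
  have hPmem : ∀ x, R • P x ∈ closedBall (0 : E) R := fun x => by
    simp only [P, mem_closedBall_zero_iff, norm_smul, norm_inv]
    rw [Real.norm_of_nonneg hR.le, Real.norm_of_nonneg (by positivity)]
    refine mul_le_of_le_one_right hR.le ?_
    rw [inv_mul_le_iff₀ (by positivity)]
    simp
  have hgP : Continuous fun x => g (R • P x) :=
    hg.comp_continuous (hP.const_smul R) hPmem
  have hne : ∀ x, ‖g (R • P x)‖ ≠ 0 := fun x => norm_ne_zero_iff.2 (h0 _ (hPmem x))
  obtain ⟨x, -, hx⟩ := exists_fixedPoint_closedBall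
    (F := fun x => -(‖g (R • P x)‖⁻¹ • g (R • P x)))
    ((hgP.norm.inv₀ hne).smul hgP).neg (fun x _ => by
      simp [norm_smul, inv_mul_cancel₀ (hne x)])
  have hx1 : ‖x‖ = 1 := by
    rw [← hx, norm_neg, norm_smul, norm_inv, norm_norm, inv_mul_cancel₀ (hne x)]
  have hPx : P x = x := by simp [P, hx1]
  have hne' := hne x
  simp only [hPx] at hx hne'
  refine ⟨R • x, by simp [norm_smul, hx1, abs_of_pos hR], ‖g (R • x)‖ / R,
    div_pos (norm_pos_iff.2 (norm_ne_zero_iff.1 hne')) hR, ?_⟩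
  rw [smul_smul, div_mul_cancel₀ _ hR.ne']
  nth_rw 3 [← hx]
  rw [smul_neg, neg_neg, smul_smul, mul_inv_cancel₀ hne', one_smul]

/-- A map whose restriction to a sphere is linearly homotopic to the identity away from the
center attains the center, stably under perturbation. -/
theorem exists_pos_forall_exists_eq_zero {h : E → E} {b : E} {δ : ℝ} (hδ : 0 < δ)
    (hh : ContinuousOn h (closedBall b δ))
    (hs : ∀ v ∈ sphere b δ, ∀ t ∈ Icc (0 : ℝ) 1, (1 - t) • (v - b) + t • (h v - b) ≠ 0) :
    ∃ η > 0, ∀ h' : E → E, ContinuousOn h' (closedBall b δ) →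
      (∀ v ∈ closedBall b δ, ‖h' v - (h v - b)‖ < η) → ∃ v ∈ closedBall b δ, h' v = 0 := by
  obtain ⟨η, hη, hηs⟩ : ∃ η > 0, ∀ v ∈ sphere b δ, ∀ t ∈ Icc (0 : ℝ) 1,
      η ≤ ‖(1 - t) • (v - b) + t • (h v - b)‖ := by
    let K : Set (E × ℝ) := sphere b δ ×ˢ Icc 0 1
    have hK : IsCompact K := (isCompact_sphere b δ).prod isCompact_Icc
    have hcont : ContinuousOn (fun p : E × ℝ => ‖(1 - p.2) • (p.1 - b) + p.2 • (h p.1 - b)‖) K := by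
      have h1 : ContinuousOn (fun p : E × ℝ => h p.1) K :=
        (hh.mono sphere_subset_closedBall).comp continuousOn_fst fun p hp => hp.1
      exact (((continuousOn_const.sub continuousOn_snd).smul
        (continuousOn_fst.sub continuousOn_const)).add
        (continuousOn_snd.smul (h1.sub continuousOn_const))).norm
    rcases K.eq_empty_or_nonempty with hKe | hKn
    · refine ⟨1, one_pos, fun v hv t ht => ?_⟩
      have : (v, t) ∈ K := ⟨hv, ht⟩
      simp [hKe] at this
    · obtain ⟨p, hp, hmin⟩ := hK.exists_isMinOn hKn hcont
      exact ⟨_, norm_pos_iff.2 (hs p.1 hp.1 p.2 hp.2), fun v hv t ht => hmin (a := (v, t)) ⟨hv, ht⟩⟩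
  refine ⟨η, hη, fun h' hh' hclose => ?_⟩
  by_contra! hne
  have hmaps : MapsTo (fun x : E => b + x) (closedBall 0 δ) (closedBall b δ) := fun x hx => by
    simpa using hx
  obtain ⟨v, hv, c, hc, hvc⟩ := exists_sphere_eq_neg_smul hδ (g := fun x => h' (b + x))
    (hh'.comp (by fun_prop) hmaps) (fun x hx => hne _ (hmaps hx))
  have hv' : b + v ∈ sphere b δ := by simpa using hv
  have h1 := hηs (b + v) hv' (1 / (1 + c)) ⟨by positivity, by
    rw [div_le_one (by positivity)]; linarith⟩
  have h2 := hclose (b + v) (sphere_subset_closedBall hv')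
  rw [hvc] at h2
  have h3 : (1 - 1 / (1 + c)) • (b + v - b) + (1 / (1 + c)) • (h (b + v) - b) =
      (1 / (1 + c)) • -(-(c • v) - (h (b + v) - b)) := by
    have : 1 - 1 / (1 + c) = 1 / (1 + c) * c := by field_simp; ring
    rw [this, mul_smul, ← smul_add]
    congr 1
    rw [add_sub_cancel_left]; abel
  rw [h3, norm_smul, norm_neg, Real.norm_of_nonneg (by positivity)] at h1
  have h4 : 1 / (1 + c) ≤ 1 := by rw [div_le_one (by positivity)]; linarith
  have h5 := norm_nonneg (-(c • v) - (h (b + v) - b))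
  nlinarith [mul_le_of_le_one_left h5 h4]
end Brouwer

section Perturbation
variable {E : Type*} [NormedAddCommGroup E] [InnerProductSpace ℝ E] [FiniteDimensional ℝ E]

/-- A map into `E` defined on a compact subset of `E` with empty interior can be perturbed so as
to avoid the origin. -/
theorem exists_near_forall_ne_zero {P : Set E} (hP : IsCompact P) (hint : interior P = ∅)
    {g : E → E} (hg : Continuous g) {ε : ℝ} (hε : 0 < ε) :
    ∃ g' : E → E, Continuous g' ∧ (∀ x ∈ P, ‖g' x - g x‖ < ε) ∧ ∀ x ∈ P, g' x ≠ 0 := by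
  let _ : MeasurableSpace E := borel E
  have _ : BorelSpace E := ⟨rfl⟩
  obtain ⟨g₁, hg₁, hg₁d, -⟩ := hg.exists_contDiff_approx 1 (ε := fun _ => ε / 3)
    continuous_const (fun _ => by positivity)
  have hstrict : ∀ x, HasStrictFDerivAt g₁ (fderiv ℝ g₁ x) x := fun x =>
    hg₁.contDiffAt.hasStrictFDerivAt one_ne_zero
  -- a small regular value, by Sard
  obtain ⟨c, hcε, hc⟩ : ∃ c : E, ‖c‖ < ε / 3 ∧ ∀ x, g₁ x = c → (fderiv ℝ g₁ x).det ≠ 0 := by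
    have hnull := addHaar_image_eq_zero_of_det_fderivWithin_eq_zero (volume : Measure E)
      (f := g₁) (s := {x | (fderiv ℝ g₁ x).det = 0})
      (fun x _ => (hstrict x).hasFDerivAt.hasFDerivWithinAt) (fun x hx => hx)
    by_contra! hcon
    have hsub : ball (0 : E) (ε / 3) ⊆ g₁ '' {x | (fderiv ℝ g₁ x).det = 0} := fun c hc => by
      obtain ⟨x, hx, hx0⟩ := hcon c (by simpa using hc)
      exact ⟨x, hx0, hx⟩
    exact (measure_ball_pos volume (0 : E) (by positivity : 0 < ε / 3)).ne'
      (measure_mono_null hsub hnull)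
  have hcount : (g₁ ⁻¹' {c}).Countable := by
    have hd : DiscreteTopology (g₁ ⁻¹' {c}) := by
      rw [discreteTopology_subtype_iff]
      intro x hx
      have h1 : LinearMap.det (fderiv ℝ g₁ x : E →ₗ[ℝ] E) ≠ 0 := hc x hx
      have h2 : AntilipschitzWith _ (fderiv ℝ g₁ x) :=
        (LinearMap.equivOfDetNeZero _ h1).toContinuousLinearEquiv.antilipschitz
      have h3 := (hstrict x).hasFDerivAt.eventually_ne (c := c) ⟨_, h2⟩
      rw [← disjoint_iff, disjoint_principal_right]
      exact h3
    exact countable_coe_iff.1 (TopologicalSpace.separableSpace_iff_countable.1 inferInstance)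
  -- a small translation moves `P` off the fibre over the regular value
  obtain ⟨a, ha, haP⟩ : ∃ a : E, (∀ x ∈ P, ‖g₁ (x + a) - g₁ x‖ < ε / 3) ∧
      ∀ z ∈ g₁ ⁻¹' {c}, z - a ∉ P := by
    have hsmall : ∀ᶠ a in 𝓝 (0 : E), ∀ x ∈ P, ‖g₁ (x + a) - g₁ x‖ < ε / 3 := by
      refine hP.eventually_forall_of_forall_eventually fun x _ => ?_
      have hcont : Continuous fun p : E × E => ‖g₁ (p.2 + p.1) - g₁ p.2‖ := by
        have := hg₁.continuous
        fun_prop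
      refine hcont.continuousAt.eventually_lt continuousAt_const ?_
      simpa using by positivity
    have hdense : Dense (⋂ z ∈ g₁ ⁻¹' {c}, {a : E | z - a ∉ P}) := by
      refine dense_biInter_of_isOpen (fun z _ => ?_) hcount (fun z _ => ?_)
      · exact hP.isClosed.isOpen_compl.preimage (by fun_prop : Continuous fun a : E => z - a)
      · have h1 : Dense Pᶜ := interior_eq_empty_iff_dense_compl.1 hint
        exact h1.preimage (Homeomorph.subLeft z).isOpenMap
    obtain ⟨a, haz, ha⟩ := hdense.inter_nhds_nonempty hsmall
    exact ⟨a, ha, fun z hz => by simpa using mem_iInter₂.1 haz z hz⟩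
  refine ⟨fun x => g₁ (x + a) - c, ?_, fun x hx => ?_, fun x hx h => ?_⟩
  · have := hg₁.continuous
    fun_prop
  · have h1 := ha x hx
    have h2 := hg₁d x
    rw [dist_eq_norm] at h2
    calc ‖g₁ (x + a) - c - g x‖ = ‖(g₁ (x + a) - g₁ x) + (g₁ x - g x) - c‖ := by congr 1; abel
      _ ≤ ‖(g₁ (x + a) - g₁ x)‖ + ‖g₁ x - g x‖ + ‖c‖ :=
        (norm_sub_le _ _).trans (add_le_add_left (norm_add_le _ _) _)
      _ < ε := by linarith
  · exact haP (x + a) (sub_eq_zero.1 h) (by simpa using hx)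
end Perturbation

section Extension
/-- Tietze extension along a map that is injective on a compact set. -/
theorem IsCompact.exists_continuousMap_comp_eqOn.{u, v, w} {X : Type u} {Y : Type v}
    {Z : Type w} [TopologicalSpace X] [TopologicalSpace Y] [NormalSpace Y] [T2Space Y]
    [TopologicalSpace Z] [TietzeExtension.{v} Z]
    {P : Set X} (hP : IsCompact P) {f : X → Y} (hf : ContinuousOn f P) (hinj : InjOn f P)
    {g : X → Z} (hg : ContinuousOn g P) : ∃ G : C(Y, Z), ∀ x ∈ P, G (f x) = g x := by
  have := isCompact_iff_compactSpace.1 hP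
  have he : IsClosedEmbedding (P.domRestrict f) :=
    hf.domRestrict.isClosedEmbedding (injOn_iff_injective.1 hinj)
  obtain ⟨G, hG⟩ := ContinuousMap.exists_extension he ⟨P.domRestrict g, hg.domRestrict⟩
  exact ⟨G, fun x hx => DFunLike.congr_fun hG (⟨x, hx⟩ : P)⟩

variable {E : Type*} [NormedAddCommGroup E] [InnerProductSpace ℝ E] [FiniteDimensional ℝ E]

/-- A weak form of invariance of domain: an injective continuous image of a ball has nonempty
interior. -/
theorem interior_image_closedBall_nonempty {f : E → E} {R : ℝ} (hR : 0 < R)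
    (hf : ContinuousOn f (closedBall 0 R)) (hinj : InjOn f (closedBall 0 R)) :
    (interior (f '' closedBall 0 R)).Nonempty := by
  by_contra hint
  rw [not_nonempty_iff_eq_empty] at hint
  have hB := isCompact_closedBall (0 : E) R
  obtain ⟨G, hG⟩ := hB.exists_continuousMap_comp_eqOn hf hinj continuousOn_id
  obtain ⟨G', hG', hnear, hne⟩ :=
    exists_near_forall_ne_zero (hB.image_of_continuousOn hf) hint G.continuous hR
  obtain ⟨v, hv, c, hc, hvc⟩ := exists_sphere_eq_neg_smul hR (g := fun v => G' (f v))
    (hG'.comp_continuousOn hf) (fun x hx => hne _ (mem_image_of_mem f hx))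
  have hvB := sphere_subset_closedBall hv
  have h1 := hnear _ (mem_image_of_mem f hvB)
  rw [hG v hvB, hvc, id, ← neg_add', norm_neg,
    show c • v + v = (c + 1) • v by rw [add_smul, one_smul],
    norm_smul, mem_sphere_zero_iff_norm.1 hv, Real.norm_of_nonneg (by positivity)] at h1
  nlinarith

/-- Continuous maps into `E` can be perturbed to avoid the origin on an injective image of a compact
set that embeds into `E` with empty interior. -/
theorem exists_continuousMap_near_ne_zero {X Q : Type*} [TopologicalSpace X]
    [TopologicalSpace Q] [NormalSpace Q] [T2Space Q] {P : Set X} (hP : IsCompact P)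
    {q : X → Q} (hq : ContinuousOn q P) (hqinj : InjOn q P) {φ : X → E} (hφ : ContinuousOn φ P)
    (hφinj : InjOn φ P) (hint : interior (φ '' P) = ∅) (g : C(Q, E)) {ε : ℝ} (hε : 0 < ε) :
    ∃ g' : C(Q, E), (∀ x, ‖g' x - g x‖ ≤ ε) ∧ ∀ z ∈ P, g' (q z) ≠ 0 := by
  obtain ⟨G, hG⟩ := hP.exists_continuousMap_comp_eqOn hφ hφinj (g.continuous.comp_continuousOn hq)
  obtain ⟨G', hG', hnear, hne⟩ :=
    exists_near_forall_ne_zero (hP.image_of_continuousOn hφ) hint G.continuous hε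
  obtain ⟨D, hD⟩ := hP.exists_continuousMap_comp_eqOn hq hqinj
    (g := fun z => ε⁻¹ • (G' (φ z) - g (q z)))
    (((hG'.comp_continuousOn hφ).sub (g.continuous.comp_continuousOn hq)).const_smul _)
  have hr := (lipschitzWith_radial_retraction (E := E)).continuous
  refine ⟨⟨fun x => g x + ε • ((max 1 ‖D x‖)⁻¹ • D x), ?_⟩, fun x => ?_, fun z hz => ?_⟩
  · exact g.continuous.add ((hr.comp D.continuous).const_smul ε)
  · simp only [ContinuousMap.coe_mk, add_sub_cancel_left, norm_smul, norm_inv]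
    rw [Real.norm_of_nonneg hε.le, Real.norm_of_nonneg (by positivity)]
    refine mul_le_of_le_one_right hε.le ?_
    rw [inv_mul_le_iff₀ (by positivity)]
    simp
  · have h1 := hnear _ (mem_image_of_mem φ hz)
    rw [hG z hz] at h1
    have h2 : ‖D (q z)‖ ≤ 1 := by
      rw [hD z hz, norm_smul, norm_inv, Real.norm_of_nonneg hε.le, inv_mul_le_iff₀ hε, mul_one]
      exact h1.le
    simp only [ContinuousMap.coe_mk]
    rw [max_eq_left h2, inv_one, one_smul, hD z hz, smul_inv_smul₀ hε.ne', add_sub_cancel]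
    exact hne _ (mem_image_of_mem φ hz)

/-- The countable version of `exists_continuousMap_near_ne_zero`. -/
theorem exists_continuousMap_near_forall_ne_zero {X Q ι : Type*} [Countable ι] [TopologicalSpace X]
    [TopologicalSpace Q] [CompactSpace Q] [T2Space Q] {P : ι → Set X} (hP : ∀ i, IsCompact (P i))
    {q : X → Q} (hq : ∀ i, ContinuousOn q (P i)) (hqinj : ∀ i, InjOn q (P i)) {φ : X → E}
    (hφ : ∀ i, ContinuousOn φ (P i)) (hφinj : ∀ i, InjOn φ (P i))
    (hint : ∀ i, interior (φ '' P i) = ∅) (g : C(Q, E)) {ε : ℝ} (hε : 0 < ε) :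
    ∃ g' : C(Q, E), (∀ x, ‖g' x - g x‖ < ε) ∧ ∀ i, ∀ z ∈ P i, g' (q z) ≠ 0 := by
  have hdense : Dense (⋂ i, {g' : C(Q, E) | MapsTo g' (q '' P i) {0}ᶜ}) := by
    refine dense_iInter_of_isOpen (fun i => ?_) (fun i => ?_)
    · exact ContinuousMap.isOpen_setOfPred_mapsTo ((hP i).image_of_continuousOn (hq i))
        isOpen_compl_singleton
    · rw [Metric.dense_iff]
      intro g r hr
      obtain ⟨g', h1, h2⟩ := exists_continuousMap_near_ne_zero (hP i) (hq i) (hqinj i) (hφ i)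
        (hφinj i) (hint i) g (half_pos hr)
      refine ⟨g', ?_, ?_⟩
      · rw [mem_ball]
        refine lt_of_le_of_lt ((ContinuousMap.dist_le (half_pos hr).le).2 fun x => ?_)
          (half_lt_self hr)
        rw [dist_eq_norm]
        exact h1 x
      · rintro _ ⟨z, hz, rfl⟩
        exact h2 z hz
  obtain ⟨g', h1, h2⟩ := Metric.dense_iff.1 hdense g ε hε
  refine ⟨g', fun x => ?_, fun i z hz => mem_iInter.1 h2 i (mem_image_of_mem q hz)⟩
  rw [← dist_eq_norm]
  exact (ContinuousMap.dist_apply_le_dist x).trans_lt h1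
end Extension

section Touching
variable {E : Type*} [NormedAddCommGroup E] [InnerProductSpace ℝ E] [FiniteDimensional ℝ E]

/-- A closed set with a boundary point in the closure of its interior is touched from inside by a
closed ball in the chart. -/
theorem exists_touching_closedBall {X : Type*} [TopologicalSpace X] (φ : OpenPartialHomeomorph X E)
    {K : Set X} (hK : IsClosed K) {a : X} (ha : a ∈ φ.source) (hcl : a ∈ closure (interior K))
    (hint : a ∉ interior K) : ∃ p : E, ∃ r > 0, ∃ b ∈ φ.source, b ∈ K ∧ b ∉ interior K ∧
      φ b ∈ sphere p r ∧ closedBall p r ⊆ φ.target ∧ ∀ x ∈ closedBall p r, φ.symm x ∈ K := by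
  obtain ⟨R, hR, hRt⟩ := nhds_basis_closedBall.mem_iff.1
    (φ.open_target.mem_nhds (φ.map_source ha))
  let O : Set E := φ.target ∩ φ.symm ⁻¹' interior K
  have hO : IsOpen O := φ.isOpen_inter_preimage_symm isOpen_interior
  have haO : φ a ∈ Oᶜ := fun h => hint (by simpa [φ.left_inv ha] using h.2)
  obtain ⟨x, ⟨hxs, hxb⟩, hxK⟩ : ((φ.source ∩ φ ⁻¹' ball (φ a) (R / 4)) ∩ interior K).Nonempty :=
    mem_closure_iff.1 hcl _ (φ.isOpen_inter_preimage isOpen_ball) ⟨ha, by simpa using hR⟩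
  have hxO : φ x ∈ O := ⟨φ.map_source hxs, by simpa [φ.left_inv hxs] using hxK⟩
  obtain ⟨y, hyO, hy⟩ := hO.isClosed_compl.exists_infDist_eq_dist ⟨_, haO⟩ (φ x)
  have hr : 0 < dist (φ x) y := dist_pos.2 fun h => hyO (h ▸ hxO)
  have hrR : dist (φ x) y < R / 4 := by
    rw [← hy]
    exact (infDist_le_dist_of_mem haO).trans_lt hxb
  have hballt : closedBall (φ x) (dist (φ x) y) ⊆ φ.target := by
    refine (closedBall_subset_closedBall' ?_).trans hRt
    have := mem_ball.1 hxb
    linarith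
  have hball : ball (φ x) (dist (φ x) y) ⊆ O := by
    rw [← hy]
    simpa using ball_infDist_compl_subset (s := O) (x := φ x)
  have hcK : ∀ z ∈ closedBall (φ x) (dist (φ x) y), φ.symm z ∈ K := fun z hz => by
    have hz' : z ∈ closure (ball (φ x) (dist (φ x) y)) := by rwa [closure_ball _ hr.ne']
    have hc := (φ.continuousAt_symm (hballt hz)).continuousWithinAt
      (s := ball (φ x) (dist (φ x) y))
    have hsub : φ.symm '' ball (φ x) (dist (φ x) y) ⊆ K := by
      rintro _ ⟨w, hw, rfl⟩
      exact interior_subset (hball hw).2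
    exact hK.closure_subset_iff.2 hsub (hc.mem_closure_image hz')
  have hyB : y ∈ closedBall (φ x) (dist (φ x) y) := by simp [dist_comm]
  refine ⟨φ x, _, hr, φ.symm y, φ.map_target (hballt hyB), hcK y hyB,
    fun h => hyO ⟨hballt hyB, h⟩, ?_, hballt, hcK⟩
  rw [φ.right_inv (hballt hyB), mem_sphere, dist_comm]
end Touching

section Slices
variable {X : Type*} [TopologicalSpace X] [T2Space X] [CompactSpace X]
  [AddAction (AddCircle (1 : ℝ)) X] [ContinuousVAdd (AddCircle (1 : ℝ)) X]

theorem t2Space_quotient_addOrbitRel :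
    T2Space (Quotient (AddAction.orbitRel (AddCircle (1 : ℝ)) X)) := by
  have : ProperVAdd (AddCircle (1 : ℝ)) X :=
    ⟨Continuous.isProperMap (by fun_prop)⟩
  infer_instance

/-- A point whose stabilizer in the circle is a neighbourhood of `0` is fixed. -/
theorem forall_vadd_eq_of_eventually {X : Type*} [AddAction (AddCircle (1 : ℝ)) X] {z : X}
    (h : ∀ᶠ s in 𝓝 (0 : AddCircle (1 : ℝ)), s +ᵥ z = z) (s : AddCircle (1 : ℝ)) :
    s +ᵥ z = z := by
  have h1 : IsOpen (AddAction.stabilizer (AddCircle (1 : ℝ)) z : Set (AddCircle (1 : ℝ))) :=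
    AddSubgroup.isOpen_of_mem_nhds _ (g := 0) h
  have h2 := AddSubgroup.isClosed_of_isOpen _ h1
  have h3 := IsClopen.eq_univ ⟨h2, h1⟩ ⟨0, AddSubgroup.zero_mem _⟩
  exact (Set.ext_iff.1 h3 s).2 trivial

theorem exists_fourier_mul_eq_norm {k : ℤ} (hk : k ≠ 0) (c : ℂ) :
    ∃ s : AddCircle (1 : ℝ), fourier k s * c = ‖c‖ := by
  refine ⟨((-c.arg / (2 * Real.pi * k) : ℝ) : AddCircle (1 : ℝ)), ?_⟩
  rw [fourier_coe_apply]
  nth_rw 2 [← Complex.norm_mul_exp_arg_mul_I c]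
  rw [mul_left_comm, ← Complex.exp_add]
  have h1 : (k : ℂ) ≠ 0 := by exact_mod_cast hk
  have h2 : (Real.pi : ℂ) ≠ 0 := by exact_mod_cast Real.pi_ne_zero
  have h3 : 2 * Real.pi * Complex.I * k * ((-c.arg / (2 * Real.pi * k) : ℝ) : ℂ) / (1 : ℝ)
      + c.arg * Complex.I = 0 := by
    push_cast
    field_simp
    ring
  rw [h3, Complex.exp_zero, mul_one]

theorem zsmul_eq_zero_of_fourier_eq_one {k : ℤ} {s : AddCircle (1 : ℝ)} (h : fourier k s = 1) :
    k • s = 0 := by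
  rw [fourier_apply] at h
  have : AddCircle.toCircle (k • s) = AddCircle.toCircle (0 : AddCircle (1 : ℝ)) := by
    rw [AddCircle.toCircle_zero]
    exact Subtype.ext h
  exact AddCircle.injective_toCircle one_ne_zero this

variable {ι : Type*} [Countable ι] {k : ι → ℤ} {u : ι → C(X, ℂ)}
  {E : Type*} [NormedAddCommGroup E] [InnerProductSpace ℝ E] [FiniteDimensional ℝ E]

/-- Invariant maps to `E` can be perturbed to avoid the origin on an invariant compact set without
fixed points that is contained in a chart domain. -/
theorem exists_near_forall_quotient_ne_zero (hk : ∀ i, k i ≠ 0)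
    (hu : ∀ i (s : AddCircle (1 : ℝ)) z, u i (s +ᵥ z) = fourier (k i) s * u i z)
    (hfix : ∀ z : X, (∃ s : AddCircle (1 : ℝ), s +ᵥ z ≠ z) →
      ∃ i, u i z ≠ 0 ∧ ∀ s : AddCircle (1 : ℝ), k i • s = 0 → s +ᵥ z = z)
    (φ : OpenPartialHomeomorph X E) {C : Set X} (hC : IsClosed C) (hCφ : C ⊆ φ.source)
    (hCinv : ∀ (s : AddCircle (1 : ℝ)), ∀ z ∈ C, s +ᵥ z ∈ C)
    (hCfix : ∀ z ∈ C, ∃ s : AddCircle (1 : ℝ), s +ᵥ z ≠ z)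
    (g : C(Quotient (AddAction.orbitRel (AddCircle (1 : ℝ)) X), E)) {ε : ℝ} (hε : 0 < ε) :
    ∃ g' : C(Quotient (AddAction.orbitRel (AddCircle (1 : ℝ)) X), E),
      (∀ x, ‖g' x - g x‖ < ε) ∧ ∀ z ∈ C, g' (Quotient.mk _ z) ≠ 0 := by
  have := t2Space_quotient_addOrbitRel (X := X)
  let q : X → Quotient (AddAction.orbitRel (AddCircle (1 : ℝ)) X) := Quotient.mk _
  have hq : Continuous q := continuous_quot_mk
  have hqs : ∀ (s : AddCircle (1 : ℝ)) z, q (s +ᵥ z) = q z := fun s z =>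
    Quotient.sound (AddAction.orbitRel_apply.2 ⟨s, rfl⟩)
  let P : ι × ℕ → Set X := fun i => {z | z ∈ C ∧
    (∀ s : AddCircle (1 : ℝ), k i.1 • s = 0 → s +ᵥ z = z) ∧
    (u i.1 z).im = 0 ∧ 1 / ((i.2 : ℝ) + 1) ≤ (u i.1 z).re}
  have hPC : ∀ i, P i ⊆ C := fun i z hz => hz.1
  have hP : ∀ i, IsCompact (P i) := fun i => by
    refine IsClosed.isCompact ?_
    have hui := (u i.1).continuous
    refine hC.inter (IsClosed.inter ?_ (IsClosed.inter ?_ ?_))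
    · have : {z : X | ∀ s : AddCircle (1 : ℝ), k i.1 • s = 0 → s +ᵥ z = z} =
          ⋂ s : AddCircle (1 : ℝ), ⋂ _ : k i.1 • s = 0, {z | s +ᵥ z = z} := by ext; simp
      change IsClosed {z : X | ∀ s : AddCircle (1 : ℝ), k i.1 • s = 0 → s +ᵥ z = z}
      rw [this]
      exact isClosed_iInter fun s => isClosed_iInter fun _ =>
        isClosed_eq (by fun_prop) continuous_id
    · exact isClosed_eq (Complex.continuous_im.comp hui) continuous_const
    · exact isClosed_le continuous_const (Complex.continuous_re.comp hui)
  have hnorm : ∀ i, ∀ z ∈ P i, u i.1 z = (‖u i.1 z‖ : ℂ) ∧ u i.1 z ≠ 0 := fun i z hz => by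
    obtain ⟨-, -, him, hre⟩ := hz
    have h0 : 0 < (u i.1 z).re := lt_of_lt_of_le (by positivity) hre
    have h1 : u i.1 z = ((u i.1 z).re : ℂ) := Complex.ext (by simp) (by simp [him])
    refine ⟨?_, fun h => by simp [h] at h0⟩
    rw [h1, Complex.norm_real, Real.norm_of_nonneg h0.le]
  have hqinj : ∀ i, InjOn q (P i) := fun i z hz z' hz' h => by
    obtain ⟨s, rfl⟩ := AddAction.orbitRel_apply.1 (Quotient.exact h)
    simp only at hz ⊢
    obtain ⟨h1, h2⟩ := hnorm i _ hz
    obtain ⟨h3, h4⟩ := hnorm i _ hz'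
    refine hz'.2.1 s (zsmul_eq_zero_of_fourier_eq_one ?_)
    have h5 := hu i.1 s z'
    have h6 : ‖u i.1 (s +ᵥ z')‖ = ‖u i.1 z'‖ := by
      rw [h5, norm_mul, fourier_apply, Circle.norm_coe, one_mul]
    rw [h6, ← h3] at h1
    rw [h1] at h5
    exact (mul_eq_right₀ h4).1 h5.symm
  have hint : ∀ i, interior (φ '' P i) = ∅ := fun i => by
    rw [eq_empty_iff_forall_notMem]
    intro v hv
    obtain ⟨z, hz, rfl⟩ := interior_subset hv
    have hzs := hCφ (hPC i hz)
    obtain ⟨s, hs⟩ := hCfix z (hPC i hz)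
    refine hs (forall_vadd_eq_of_eventually ?_ s)
    have h1 : φ.source ∩ φ ⁻¹' interior (φ '' P i) ∈ 𝓝 z :=
      (φ.isOpen_inter_preimage isOpen_interior).mem_nhds ⟨hzs, hv⟩
    have h2 : Tendsto (fun s : AddCircle (1 : ℝ) => s +ᵥ z) (𝓝 0) (𝓝 z) := by
      have : Continuous fun s : AddCircle (1 : ℝ) => s +ᵥ z := by fun_prop
      simpa using this.tendsto 0
    filter_upwards [h2 h1] with s hs
    obtain ⟨hs1, hs2⟩ := hs
    obtain ⟨z', hz', h3⟩ := interior_subset hs2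
    have h4 : z' = s +ᵥ z := φ.injOn (hCφ (hPC i hz')) hs1 h3
    exact hqinj i (h4 ▸ hz') hz (hqs s z)
  obtain ⟨g', h1, h2⟩ := exists_continuousMap_near_forall_ne_zero hP
    (fun _ => hq.continuousOn) hqinj (fun i => φ.continuousOn.mono ((hPC i).trans hCφ))
    (fun i => φ.injOn.mono ((hPC i).trans hCφ)) hint g hε
  refine ⟨g', h1, fun z hz => ?_⟩
  obtain ⟨i, hi, hi'⟩ := hfix z (hCfix z hz)
  obtain ⟨s, hs⟩ := exists_fourier_mul_eq_norm (hk i) (u i z)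
  obtain ⟨l, hl⟩ := exists_nat_one_div_lt (norm_pos_iff.2 hi)
  have h3 := h2 (i, l) (s +ᵥ z) ⟨hCinv s z hz, fun t ht => by
    rw [vadd_vadd, add_comm, ← vadd_vadd, hi' t ht], by rw [hu, hs, Complex.ofReal_im],
    by rw [hu, hs, Complex.ofReal_re]; exact hl.le⟩
  rwa [hqs] at h3
end Slices

section Newman
variable {X : Type*} [TopologicalSpace X] [AddAction (AddCircle (1 : ℝ)) X]
  [ContinuousVAdd (AddCircle (1 : ℝ)) X]
  {E : Type*} [NormedAddCommGroup E] [InnerProductSpace ℝ E] [FiniteDimensional ℝ E]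

/-- The average over orbits of a map, as a map on the orbit space. -/
theorem exists_average [CompactSpace X] [FirstCountableTopology X] (Ψ : C(X, E)) :
    ∃ F : C(Quotient (AddAction.orbitRel (AddCircle (1 : ℝ)) X), E),
      ∀ z, F (Quotient.mk _ z) = ∫ s : AddCircle (1 : ℝ), Ψ (s +ᵥ z) ∂AddCircle.haarAddCircle := by
  let f : X → E := fun z => ∫ s : AddCircle (1 : ℝ), Ψ (s +ᵥ z) ∂AddCircle.haarAddCircle
  have hf : Continuous f := by
    refine continuous_of_dominated (bound := fun _ => ‖Ψ‖) (fun z => ?_)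
      (fun z => .of_forall fun s => Ψ.norm_coe_le_norm _) (integrable_const _)
      (.of_forall fun s => ?_)
    · exact Continuous.aestronglyMeasurable (by fun_prop)
    · fun_prop
  have hinv : ∀ a b : X, (AddAction.orbitRel (AddCircle (1 : ℝ)) X) a b → f a = f b := by
    intro a b h
    obtain ⟨t, rfl⟩ := AddAction.orbitRel_apply.1 h
    simp only [f, vadd_vadd]
    exact integral_add_right_eq_self (fun s => Ψ (s +ᵥ b)) t
  exact ⟨⟨Quotient.lift f hinv, hf.quotient_lift hinv⟩, fun z => rfl⟩

theorem average_mem_ball {Ψ : C(X, E)} {z : X} {p : E} {r : ℝ}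
    (h : ∀ s : AddCircle (1 : ℝ), Ψ (s +ᵥ z) ∈ ball p r) :
    ∫ s : AddCircle (1 : ℝ), Ψ (s +ᵥ z) ∂AddCircle.haarAddCircle ∈ ball p r := by
  have hc : Continuous fun s : AddCircle (1 : ℝ) => Ψ (s +ᵥ z) := by fun_prop
  obtain ⟨s₀, -, hs₀⟩ := isCompact_univ.exists_isMaxOn univ_nonempty
    (hc.dist continuous_const : Continuous fun s => dist (Ψ (s +ᵥ z)) p).continuousOn
  have h1 := (convex_closedBall p (dist (Ψ (s₀ +ᵥ z)) p)).integral_mem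
    (μ := AddCircle.haarAddCircle) isClosed_closedBall (.of_forall fun s => hs₀ (mem_univ s))
    (hc.integrable_of_hasCompactSupport (HasCompactSupport.of_compactSpace _))
  exact mem_ball.2 ((mem_closedBall.1 h1).trans_lt (mem_ball.1 (h s₀)))

variable {ι : Type*} [Countable ι] {k : ι → ℤ} {u : ι → C(X, ℂ)}

/-- **Newman's theorem** for circle actions: the fixed point set of a nontrivial circle action on a
connected manifold has empty interior. -/
theorem interior_fixedPoints_eq_empty [T2Space X] [CompactSpace X] [FirstCountableTopology X]
    [ConnectedSpace X] [ChartedSpace E X] (hk : ∀ i, k i ≠ 0)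
    (hu : ∀ i (s : AddCircle (1 : ℝ)) z, u i (s +ᵥ z) = fourier (k i) s * u i z)
    (hfix : ∀ z : X, (∃ s : AddCircle (1 : ℝ), s +ᵥ z ≠ z) →
      ∃ i, u i z ≠ 0 ∧ ∀ s : AddCircle (1 : ℝ), k i • s = 0 → s +ᵥ z = z)
    (hne : ∃ (s : AddCircle (1 : ℝ)) (z : X), s +ᵥ z ≠ z) :
    interior {z : X | ∀ s : AddCircle (1 : ℝ), s +ᵥ z = z} = ∅ := by
  set K : Set X := {z : X | ∀ s : AddCircle (1 : ℝ), s +ᵥ z = z} with hKdef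
  have hK : IsClosed K := by
    simp only [hKdef, ofPred_forall]
    exact isClosed_iInter fun s => isClosed_eq (by fun_prop) continuous_id
  have hKinv : ∀ (s : AddCircle (1 : ℝ)) z, s +ᵥ z ∈ K → z ∈ K := fun s z h t => by
    have h1 := h t
    rw [vadd_vadd, add_comm, ← vadd_vadd] at h1
    exact vadd_left_cancel s h1
  by_contra hemp
  rw [← ne_eq, ← nonempty_iff_ne_empty] at hemp
  obtain ⟨a, hacl, haint⟩ : ∃ a ∈ closure (interior K), a ∉ interior K := by
    by_contra! hcon
    have h1 : IsClopen (interior K) := ⟨closure_subset_iff_isClosed.1 hcon, isOpen_interior⟩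
    obtain ⟨s, z, hsz⟩ := hne
    exact hsz (interior_subset ((h1.eq_univ hemp).ge (mem_univ z)) s)
  let φ := chartAt E a
  obtain ⟨p, r, hr, b, hbs, hbK, hbint, hbp, hpt, hpK⟩ :=
    exists_touching_closedBall φ hK (mem_chart_source E a) hacl haint
  let inv : E → E := EuclideanGeometry.inversion p r
  have hinv : ∀ v ≠ p, ContinuousAt inv v := fun v hv =>
    continuousAt_const.inversion continuousAt_const continuousAt_id hv
  have hinvinv : ∀ v, inv (inv v) = v := EuclideanGeometry.inversion_inversion p hr.ne'
  have hinvb : inv (φ b) = φ b := EuclideanGeometry.inversion_of_mem_sphere hbp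
  have hbp' : φ b ≠ p := fun h => by
    rw [mem_sphere, h, dist_self] at hbp
    exact hr.ne hbp
  have hinvout : ∀ v, v ∉ closedBall p r → inv v ∈ ball p r := fun v hv => by
    rw [mem_closedBall, not_le] at hv
    rw [mem_ball, EuclideanGeometry.dist_inversion_center, div_lt_iff₀ (hr.trans hv)]
    nlinarith
  have hinvout' : ∀ v, v ∉ ball p r → inv v ∈ closedBall p r := fun v hv => by
    rw [mem_ball, not_lt] at hv
    rw [mem_closedBall, EuclideanGeometry.dist_inversion_center, div_le_iff₀ (hr.trans_le hv)]
    nlinarith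
  -- a closed neighbourhood of `b` in the domain of the inverted chart
  obtain ⟨N, hNb, hN, hNs⟩ : ∃ N ∈ 𝓝 b, IsClosed N ∧ N ⊆ {x | x ∈ φ.source ∧ φ x ≠ p} := by
    refine exists_mem_nhds_isClosed_subset ?_
    filter_upwards [φ.open_source.mem_nhds hbs,
      (φ.continuousAt hbs).eventually_ne hbp'] with x h1 h2 using ⟨h1, h2⟩
  have hinvφ : ContinuousOn (fun x => inv (φ x)) N := fun x hx =>
    ((hinv _ (hNs hx).2).comp (φ.continuousAt (hNs hx).1)).continuousWithinAt
  obtain ⟨Ψ, hΨ⟩ := hN.isCompact.exists_continuousMap_comp_eqOn continuousOn_id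
    (injOn_id N) hinvφ
  simp only [id] at hΨ
  obtain ⟨F, hF⟩ := exists_average Ψ
  let V : Set X := {z | ∀ s : AddCircle (1 : ℝ), s +ᵥ z ∈ N}
  have hV : IsClosed V := by
    simp only [V, ofPred_forall]
    exact isClosed_iInter fun s => hN.preimage (by fun_prop)
  have hVN : V ⊆ N := fun z hz => by simpa using hz 0
  have hVinv : ∀ (s : AddCircle (1 : ℝ)), ∀ z ∈ V, s +ᵥ z ∈ V := fun s z hz t => by
    rw [vadd_vadd]
    exact hz _
  have hVb : V ∈ 𝓝 b := by
    have : ∀ᶠ z in 𝓝 b, ∀ s ∈ (univ : Set (AddCircle (1 : ℝ))), s +ᵥ z ∈ N := by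
      refine isCompact_univ.eventually_forall_of_forall_eventually fun s _ => ?_
      have h1 : Continuous fun p : X × AddCircle (1 : ℝ) => p.2 +ᵥ p.1 := by fun_prop
      have h2 : s +ᵥ b = b := hbK s
      refine h1.continuousAt.eventually ?_
      change N ∈ 𝓝 (s +ᵥ b)
      rwa [h2]
    filter_upwards [this] with z hz s using hz s (mem_univ s)
  have hFK : ∀ z ∈ V, z ∈ K → F (Quotient.mk _ z) = inv (φ z) := fun z hz hzK => by
    have h1 : ∀ s : AddCircle (1 : ℝ), s +ᵥ z = z := hzK
    rw [hF]
    simp only [h1]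
    simp [hΨ z (hVN hz)]
  have hFK' : ∀ z ∈ V, z ∉ K → F (Quotient.mk _ z) ∈ ball p r := fun z hz hzK => by
    rw [hF]
    refine average_mem_ball fun s => ?_
    rw [hΨ _ (hz s)]
    refine hinvout _ fun h => hzK (hKinv s z ?_)
    have h1 := hpK _ h
    rwa [φ.left_inv (hNs (hz s)).1] at h1
  -- a small ball around `b` in the inverted chart
  obtain ⟨δ, hδ, hδW⟩ : ∃ δ > 0, closedBall (φ b) δ ⊆
      {v | v ≠ p ∧ inv v ∈ φ.target ∧ φ.symm (inv v) ∈ V} := by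
    refine nhds_basis_closedBall.mem_iff.1 ?_
    have hc := hinv _ hbp'
    have h1 : ∀ᶠ v in 𝓝 (inv (φ b)), v ∈ φ.target := by
      rw [hinvb]
      exact φ.open_target.mem_nhds (φ.map_source hbs)
    have h2 : ∀ᶠ v in 𝓝 (inv (φ b)), φ.symm v ∈ V := by
      rw [hinvb]
      refine (φ.continuousAt_symm (φ.map_source hbs)).eventually ?_
      rw [φ.left_inv hbs]
      exact hVb
    filter_upwards [eventually_ne_nhds hbp', hc.eventually h1, hc.eventually h2] with v h1 h2 h3
      using ⟨h1, h2, h3⟩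
  let θ : E → X := fun v => φ.symm (inv v)
  have hθ : ContinuousOn θ (closedBall (φ b) δ) := fun v hv =>
    ((φ.continuousAt_symm (hδW hv).2.1).comp (hinv v (hδW hv).1)).continuousWithinAt
  have hq : Continuous (Quotient.mk (AddAction.orbitRel (AddCircle (1 : ℝ)) X)) :=
    continuous_quot_mk
  have hseg : ∀ v ∈ sphere (φ b) δ, ∀ t ∈ Icc (0 : ℝ) 1,
      (1 - t) • (v - φ b) + t • (F (Quotient.mk _ (θ v)) - φ b) ≠ 0 := fun v hv t ht h => by
    obtain ⟨hv1, hv2, hv3⟩ := hδW (sphere_subset_closedBall hv)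
    have h1 : (1 - t) • v + t • F (Quotient.mk _ (θ v)) = φ b := by
      rw [← sub_eq_zero, ← h]
      module
    have hvb : v ≠ φ b := fun h => by
      rw [mem_sphere, h, dist_self] at hv
      exact hδ.ne hv
    by_cases hθK : θ v ∈ K
    · rw [hFK _ hv3 hθK, φ.right_inv hv2, hinvinv, ← add_smul, sub_add_cancel, one_smul] at h1
      exact hvb h1
    · have h2 : v ∈ ball p r := by
        by_contra h2
        exact hθK (hpK _ (hinvout' v h2))
      have h3 := convex_ball p r h2 (hFK' _ hv3 hθK) (sub_nonneg.2 ht.2) ht.1 (sub_add_cancel _ _)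
      rw [h1, mem_ball, mem_sphere.1 hbp] at h3
      exact lt_irrefl _ h3
  obtain ⟨η, hη, hstab⟩ := exists_pos_forall_exists_eq_zero hδ
    (F.continuous.comp_continuousOn (hq.comp_continuousOn hθ)) hseg
  -- a value near `φ b` not attained on fixed points
  obtain ⟨x, ⟨hxV, hxη⟩, hxK⟩ : ∃ x ∈ V ∩ {x | ‖inv (φ x) - φ b‖ < η / 2}, x ∉ K := by
    have h1 : V ∩ {x | ‖inv (φ x) - φ b‖ < η / 2} ∈ 𝓝 b := by
      refine inter_mem hVb ?_
      have h2 : ContinuousAt (fun x => ‖inv (φ x) - φ b‖) b :=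
        (((hinv _ hbp').comp (φ.continuousAt hbs)).sub continuousAt_const).norm
      refine h2.eventually_lt continuousAt_const ?_
      simpa [hinvb] using hη
    by_contra! hcon
    exact hbint (mem_interior_iff_mem_nhds.2 (mem_of_superset h1 hcon))
  set y := inv (φ x)
  have hFq : Continuous fun z : X => F (Quotient.mk _ z) := F.continuous.comp hq
  obtain ⟨ρ, hρ, hρK⟩ : ∃ ρ > 0, ∀ z ∈ V, z ∈ K → ρ < ‖F (Quotient.mk _ z) - y‖ := by
    have h1 : IsClosed ((fun z : X => F (Quotient.mk _ z)) '' (V ∩ K)) :=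
      ((hV.inter hK).isCompact.image hFq).isClosed
    have h2 : y ∉ (fun z : X => F (Quotient.mk _ z)) '' (V ∩ K) := by
      rintro ⟨z, ⟨hzV, hzK⟩, hz⟩
      simp only at hz
      rw [hFK z hzV hzK] at hz
      have h3 : φ z = φ x := by rw [← hinvinv (φ z), hz, hinvinv]
      have h4 : z = x := φ.injOn (hNs (hVN hzV)).1 (hNs (hVN hxV)).1 h3
      exact hxK (h4 ▸ hzK)
    obtain ⟨ρ, hρ, hsub⟩ := nhds_basis_closedBall.mem_iff.1 (h1.isOpen_compl.mem_nhds h2)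
    refine ⟨ρ, hρ, fun z hzV hzK => ?_⟩
    by_contra! h3
    exact hsub (mem_closedBall_iff_norm.2 h3) ⟨z, ⟨hzV, hzK⟩, rfl⟩
  let C : Set X := V ∩ {z | ‖F (Quotient.mk _ z) - y‖ ≤ ρ}
  have hC : IsClosed C := hV.inter (isClosed_le (hFq.sub continuous_const).norm continuous_const)
  obtain ⟨G, hG, hG0⟩ := exists_near_forall_quotient_ne_zero hk hu hfix φ hC
    (fun z hz => (hNs (hVN hz.1)).1)
    (fun s z hz => ⟨hVinv s z hz.1, by
      have h1 : (Quotient.mk (AddAction.orbitRel (AddCircle (1 : ℝ)) X) (s +ᵥ z)) =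
        Quotient.mk _ z := Quotient.sound (AddAction.orbitRel_apply.2 ⟨s, rfl⟩)
      simpa only [mem_ofPred_eq, h1] using hz.2⟩)
    (fun z hz => by
      by_contra! h
      exact (hρK z hz.1 h).not_ge hz.2)
    (F - ContinuousMap.const _ y) (lt_min hρ (half_pos hη))
  simp only [ContinuousMap.sub_apply, ContinuousMap.const_apply] at hG
  obtain ⟨v, hv, hv0⟩ := hstab (fun v => G (Quotient.mk _ (θ v)))
    (G.continuous.comp_continuousOn (hq.comp_continuousOn hθ)) (fun v hv => by
      have h1 := (hG (Quotient.mk _ (θ v))).trans_le (min_le_right _ _)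
      calc ‖G (Quotient.mk _ (θ v)) - (F (Quotient.mk _ (θ v)) - φ b)‖
          = ‖(G (Quotient.mk _ (θ v)) - (F (Quotient.mk _ (θ v)) - y)) - (y - φ b)‖ := by
            congr 1; abel
        _ ≤ _ := norm_sub_le _ _
        _ < η / 2 + η / 2 := add_lt_add h1 hxη
        _ = η := add_halves η)
  by_cases hθC : ‖F (Quotient.mk _ (θ v)) - y‖ ≤ ρ
  · exact hG0 _ ⟨(hδW hv).2.2, hθC⟩ hv0
  · have h1 := (hG (Quotient.mk _ (θ v))).trans_le (min_le_left _ _)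
    rw [hv0, zero_sub, norm_neg] at h1
    exact hθC h1.le
end Newman

open UnitAddTorus

section Weights
variable {d : Type*} [Fintype d]

theorem mFourier_apply_add (n : d → ℤ) (s t : UnitAddTorus d) :
    mFourier n (s + t) = mFourier n s * mFourier n t := by
  simp [mFourier, Finset.prod_mul_distrib, smul_add, AddCircle.toCircle_add]

theorem mFourier_eq_zero_of_integral {f : C(UnitAddTorus d, ℂ)}
    (h : ∀ n : d → ℤ, ∫ t, mFourier n t * f t ∂Measure.pi (fun _ => AddCircle.haarAddCircle) = 0) :
    f = 0 := by
  set μ : Measure (UnitAddTorus d) := Measure.pi (fun _ => AddCircle.haarAddCircle)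
  have hint : ∀ g : C(UnitAddTorus d, ℂ), Integrable (fun t => g t * f t) μ := fun g =>
    (by fun_prop : Continuous fun t => g t * f t).integrable_of_hasCompactSupport
      (HasCompactSupport.of_compactSpace _)
  let L : C(UnitAddTorus d, ℂ) →ₗ[ℂ] ℂ :=
    { toFun := fun g => ∫ t, g t * f t ∂μ
      map_add' := fun g g' => by
        simp only [ContinuousMap.add_apply, add_mul]
        exact integral_add (hint g) (hint g')
      map_smul' := fun c g => by
        simp only [ContinuousMap.smul_apply, smul_eq_mul, mul_assoc, RingHom.id_apply]
        exact integral_const_mul _ _ }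
  have hL : Continuous L := by
    refine AddMonoidHomClass.continuous_of_bound L ‖f‖ fun g => ?_
    refine (norm_integral_le_of_norm_le_const (C := ‖f‖ * ‖g‖) (.of_forall fun t => ?_)).trans ?_
    · rw [norm_mul, mul_comm]
      gcongr <;> exact ContinuousMap.norm_coe_le_norm _ _
    · simp
  have hker : (LinearMap.ker L) = ⊤ := by
    rw [eq_top_iff, ← span_mFourier_closure_eq_top]
    refine Submodule.topologicalClosure_minimal _ ?_ (isClosed_singleton.preimage hL)
    rw [Submodule.span_le]
    rintro _ ⟨n, rfl⟩
    exact h n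
  have h1 : ∫ t, ‖f t‖ ^ 2 ∂μ = 0 := by
    have h2 : L (star f) = 0 := by
      rw [← LinearMap.mem_ker, hker]
      trivial
    have h3 : L (star f) = ((∫ t, ‖f t‖ ^ 2 ∂μ : ℝ) : ℂ) := by
      rw [← integral_complex_ofReal]
      refine integral_congr_ae (.of_forall fun t => ?_)
      simp [Complex.conj_mul']
    rw [h3] at h2
    exact_mod_cast h2
  have hc : Continuous fun t => ‖f t‖ ^ 2 := by fun_prop
  by_contra hf
  obtain ⟨t, ht⟩ := DFunLike.ne_iff.1 hf
  exact (hc.integral_pos_of_hasCompactSupport_nonneg_nonzero (μ := μ) (x := t)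
    (HasCompactSupport.of_compactSpace _) (fun t => by positivity)
    (pow_ne_zero 2 (norm_ne_zero_iff.2 ht))).ne' h1

variable {X : Type*} [TopologicalSpace X] [AddAction (UnitAddTorus d) X]

variable (X) in
/-- The continuous functions of weight `n` for a torus action. -/
def weightSpace (n : d → ℤ) : Set C(X, ℂ) :=
  {v | ∀ (t : UnitAddTorus d) x, v (t +ᵥ x) = mFourier n t * v x}

/-- The weights of a torus action at a point. -/
def weightsAt (x : X) : AddSubgroup (d → ℤ) where
  carrier := {n | ∃ v ∈ weightSpace X n, v x ≠ 0}
  zero_mem' := ⟨1, fun t x => by simp [mFourier_zero], by simp⟩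
  add_mem' := by
    rintro n n' ⟨v, hv, hx⟩ ⟨v', hv', hx'⟩
    refine ⟨v * v', fun t x => ?_, mul_ne_zero hx hx'⟩
    simp only [ContinuousMap.mul_apply, hv t x, hv' t x, mFourier_add]
    ring
  neg_mem' := by
    rintro n ⟨v, hv, hx⟩
    refine ⟨star v, fun t x => ?_, by simpa using hx⟩
    simp [hv t x, mFourier_neg]

variable [CompactSpace X] [FirstCountableTopology X] [ContinuousVAdd (UnitAddTorus d) X]

theorem exists_mem_weightSpace (u : C(X, ℂ)) (n : d → ℤ) : ∃ v ∈ weightSpace X n,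
    ∀ x, v x =
      ∫ t, mFourier (-n) t * u (t +ᵥ x) ∂Measure.pi (fun _ => AddCircle.haarAddCircle) := by
  set μ : Measure (UnitAddTorus d) := Measure.pi (fun _ => AddCircle.haarAddCircle)
  refine ⟨⟨fun x => ∫ t, mFourier (-n) t * u (t +ᵥ x) ∂μ, ?_⟩, fun s x => ?_, fun x => rfl⟩
  · refine continuous_of_dominated (bound := fun _ => ‖u‖) (fun x => ?_)
      (fun x => .of_forall fun t => ?_) (integrable_const _) (.of_forall fun t => ?_)
    · exact Continuous.aestronglyMeasurable (by fun_prop)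
    · rw [norm_mul]
      refine (mul_le_mul ((mFourier (-n)).norm_coe_le_norm t) (u.norm_coe_le_norm _)
        (norm_nonneg _) (norm_nonneg _)).trans ?_
      rw [mFourier_norm, one_mul]
    · fun_prop
  · simp only [ContinuousMap.coe_mk]
    rw [← integral_add_right_eq_self (fun t => mFourier (-n) t * u (t +ᵥ x)) s,
      ← integral_const_mul]
    refine integral_congr_ae (.of_forall fun t => ?_)
    have h1 : mFourier n s * mFourier (-n) s = 1 := by
      rw [← mFourier_add, add_neg_cancel, mFourier_zero, ContinuousMap.one_apply]
    simp only [vadd_vadd, mFourier_apply_add]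
    linear_combination (-mFourier (-n) t * u ((t + s) +ᵥ x)) * h1

/-- The stabilizer of a point is determined by the weights. -/
theorem vadd_eq_of_forall_mFourier_eq_one [T2Space X] {x : X} {t : UnitAddTorus d}
    (h : ∀ n ∈ weightsAt x, mFourier n t = 1) : t +ᵥ x = x := by
  by_contra hne
  obtain ⟨u₀, hu0, hu1, -⟩ := exists_continuous_zero_one_of_isClosed
    (isClosed_singleton (x := t +ᵥ x)) (isClosed_singleton (x := x)) (by simpa using hne)
  let u : C(X, ℂ) := ⟨fun y => (u₀ y : ℂ), by fun_prop⟩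
  let f : C(UnitAddTorus d, ℂ) := ⟨fun s => u (s +ᵥ (t +ᵥ x)) - u (s +ᵥ x), by fun_prop⟩
  have hf : f ≠ 0 := fun h0 => by
    have h1 := DFunLike.congr_fun h0 0
    have h2 := hu0 (mem_singleton _)
    have h3 := hu1 (mem_singleton _)
    simp [f, u, h2, h3] at h1
  refine hf (mFourier_eq_zero_of_integral fun n => ?_)
  obtain ⟨v, hv, hvu⟩ := exists_mem_weightSpace u (-n)
  rw [neg_neg] at hvu
  have h1 : v (t +ᵥ x) = v x := by
    by_cases h0 : v x = 0
    · rw [hv, h0, mul_zero]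
    · rw [hv, h _ ⟨v, hv, h0⟩, one_mul]
  have hint : ∀ y : X, Integrable (fun s => mFourier n s * u (s +ᵥ y))
      (Measure.pi (fun _ : d => AddCircle.haarAddCircle)) := fun y =>
    (by fun_prop : Continuous fun s => mFourier n s * u (s +ᵥ y)).integrable_of_hasCompactSupport
      (HasCompactSupport.of_compactSpace _)
  simp only [f, ContinuousMap.coe_mk, mul_sub]
  rw [integral_sub (hint _) (hint _), ← hvu, ← hvu, h1, sub_self]
end Weights

section Torus
variable {m : ℕ}

/-- The circle subgroup of the torus with direction `w`. -/
def circleHom (w : Fin m → ℤ) : AddCircle (1 : ℝ) →+ UnitAddTorus (Fin m) where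
  toFun s i := w i • s
  map_zero' := by ext; simp
  map_add' s t := by ext; simp

theorem continuous_circleHom (w : Fin m → ℤ) : Continuous (circleHom w) :=
  continuous_pi fun i => continuous_zsmul (w i)

theorem mFourier_circleHom (n w : Fin m → ℤ) (s : AddCircle (1 : ℝ)) :
    mFourier n (circleHom w s) = fourier (n ⬝ᵥ w) s := by
  have h (F : Finset (Fin m)) :
      fourier (∑ i ∈ F, n i * w i) s = ∏ i ∈ F, fourier (n i) (w i • s) := by
    induction F using Finset.cons_induction with
    | empty => simp
    | cons a F ha ih =>
      rw [Finset.sum_cons, Finset.prod_cons, fourier_add, ih]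
      simp only [fourier_apply, smul_smul]
  exact (h Finset.univ).symm

theorem fourier_eq_one_of_zsmul_eq_zero {k : ℤ} {s : AddCircle (1 : ℝ)} (h : k • s = 0) :
    fourier k s = 1 := by
  rw [fourier_apply, h]
  simp

theorem exists_circleHom_ne_zero {w : Fin m → ℤ} (hw : w ≠ 0) : ∃ s, circleHom w s ≠ 0 := by
  obtain ⟨i, hi⟩ := Function.ne_iff.1 hw
  obtain ⟨s, hs⟩ := exists_fourier_mul_eq_norm hi (-1)
  refine ⟨s, fun h0 => ?_⟩
  rw [fourier_eq_one_of_zsmul_eq_zero (congr_fun h0 i)] at hs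
  norm_num at hs

variable {X : Type*} [TopologicalSpace X] [T2Space X] [CompactSpace X] [ConnectedSpace X]
  [ChartedSpace (EuclideanSpace ℝ (Fin m)) X] [AddAction (UnitAddTorus (Fin m)) X]
  [ContinuousVAdd (UnitAddTorus (Fin m)) X]

theorem interior_fixedPoints_circleHom_eq_empty
    (heff : ∀ g : UnitAddTorus (Fin m), (∀ x : X, g +ᵥ x = x) → g = 0)
    {w : Fin m → ℤ} (hw : w ≠ 0) :
    interior {z : X | ∀ s, circleHom w s +ᵥ z = z} = ∅ := by
  have : SecondCountableTopology X :=
    ChartedSpace.secondCountable_of_sigmaCompact (EuclideanSpace ℝ (Fin m)) X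
  let _ : AddAction (AddCircle (1 : ℝ)) X := AddAction.compHom X (circleHom w)
  have hdef : ∀ (s : AddCircle (1 : ℝ)) (z : X), s +ᵥ z = circleHom w s +ᵥ z := fun _ _ => rfl
  have : ContinuousVAdd (AddCircle (1 : ℝ)) X :=
    ⟨((continuous_circleHom w).comp continuous_fst).vadd continuous_snd⟩
  have hne (n : Fin m → ℤ) : Nonempty (weightSpace X n) := ⟨⟨0, fun t x => by simp⟩⟩
  refine interior_fixedPoints_eq_empty (X := X) (E := EuclideanSpace ℝ (Fin m))
    (ι := {p : (Fin m → ℤ) × ℕ // p.1 ⬝ᵥ w ≠ 0}) (k := fun p => p.1.1 ⬝ᵥ w)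
    (u := fun p => (TopologicalSpace.denseSeq (weightSpace X p.1.1) p.1.2 : C(X, ℂ)))
    (fun p => p.2) (fun p s z => ?_) (fun z hz => ?_) ?_
  · rw [hdef, ← mFourier_circleHom]
    exact (TopologicalSpace.denseSeq (weightSpace X p.1.1) p.1.2).2 _ _
  · let D : (Fin m → ℤ) →+ ℤ :=
      { toFun := fun n => n ⬝ᵥ w
        map_zero' := zero_dotProduct _
        map_add' := fun a b => add_dotProduct _ _ _ }
    obtain ⟨k, hk⟩ := Int.subgroup_cyclic ((weightsAt z).map D)
    have hkm : k ∈ (weightsAt z).map D := hk ▸ AddSubgroup.subset_closure rfl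
    obtain ⟨n, hn, hnk⟩ := hkm
    have hst : ∀ s : AddCircle (1 : ℝ), k • s = 0 → s +ᵥ z = z := fun s hs => by
      refine vadd_eq_of_forall_mFourier_eq_one fun n' hn' => ?_
      rw [mFourier_circleHom]
      apply fourier_eq_one_of_zsmul_eq_zero
      have : D n' ∈ (weightsAt z).map D := ⟨n', hn', rfl⟩
      rw [hk, AddSubgroup.mem_closure_singleton] at this
      obtain ⟨a, ha⟩ := this
      change D n' • s = 0
      rw [← ha, smul_assoc, hs, smul_zero]
    have hk0 : n ⬝ᵥ w ≠ 0 := by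
      intro h0
      obtain ⟨s, hs⟩ := hz
      refine hs (hst s ?_)
      rw [← hnk]
      change (n ⬝ᵥ w) • s = 0
      rw [h0, zero_smul]
    obtain ⟨v, hv, hvz⟩ := hn
    have hopen : IsOpen {v : weightSpace X n | (v : C(X, ℂ)) z ≠ 0} :=
      isOpen_ne_fun (by fun_prop) continuous_const
    obtain ⟨_, h1, j, rfl⟩ :=
      (TopologicalSpace.denseRange_denseSeq (weightSpace X n)).inter_open_nonempty
      _ hopen ⟨⟨v, hv⟩, hvz⟩
    refine ⟨⟨(n, j), hk0⟩, h1, fun s hs => hst s ?_⟩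
    rw [← hnk]
    exact hs
  · obtain ⟨s, hs⟩ := exists_circleHom_ne_zero hw
    by_contra! h
    exact hs (heff _ fun x => h s x)

theorem exists_forall_weightsAt_dotProduct_ne_zero
    (heff : ∀ g : UnitAddTorus (Fin m), (∀ x : X, g +ᵥ x = x) → g = 0) :
    ∃ x : X, ∀ w : Fin m → ℤ, w ≠ 0 → ∃ n ∈ weightsAt x, n ⬝ᵥ w ≠ 0 := by
  have : SecondCountableTopology X :=
    ChartedSpace.secondCountable_of_sigmaCompact (EuclideanSpace ℝ (Fin m)) X
  have hd : Dense (⋂ w : {w : Fin m → ℤ // w ≠ 0}, {z : X | ∀ s, circleHom w.1 s +ᵥ z = z}ᶜ) := by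
    refine dense_iInter_of_isOpen (fun w => ?_) fun w => ?_
    · rw [isOpen_compl_iff, ofPred_forall]
      exact isClosed_iInter fun s => isClosed_eq (by fun_prop) continuous_id
    · rw [← interior_eq_empty_iff_dense_compl]
      exact interior_fixedPoints_circleHom_eq_empty heff w.2
  obtain ⟨x, hx⟩ := hd.nonempty
  refine ⟨x, fun w hw => ?_⟩
  by_contra! h
  refine mem_iInter.1 hx ⟨w, hw⟩ fun s => vadd_eq_of_forall_mFourier_eq_one fun n hn => ?_
  rw [mFourier_circleHom, h n hn, fourier_zero]

/-- A subgroup of `ℤ ^ m` whose orthogonal complement vanishes has finite exponent quotient. -/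
theorem exists_zsmul_single_mem (Λ : AddSubgroup (Fin m → ℤ))
    (h : ∀ w : Fin m → ℤ, w ≠ 0 → ∃ n ∈ Λ, n ⬝ᵥ w ≠ 0) (i : Fin m) :
    ∃ N : ℤ, N ≠ 0 ∧ N • (Pi.single i 1 : Fin m → ℤ) ∈ Λ := by
  by_contra! hN
  let P := AddSubgroup.toIntSubmodule Λ
  let A := (Fin m → ℤ) ⧸ P
  let B := A ⧸ Submodule.torsion ℤ A
  let q : (Fin m → ℤ) →ₗ[ℤ] B := (Submodule.torsion ℤ A).mkQ ∘ₗ P.mkQ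
  have hq : q (Pi.single i 1) ≠ 0 := by
    intro h0
    have h1 : P.mkQ (Pi.single i 1) ∈ Submodule.torsion ℤ A := by
      rw [← Submodule.Quotient.mk_eq_zero]
      exact h0
    obtain ⟨⟨a, ha⟩, h2⟩ := h1
    refine hN a (nonZeroDivisors.ne_zero ha) ?_
    have h3 : P.mkQ (a • Pi.single i 1) = 0 := by rw [map_smul]; exact h2
    rw [← LinearMap.mem_ker, Submodule.ker_mkQ] at h3
    exact h3
  have : Module.Free ℤ B := inferInstance
  obtain ⟨f, hf⟩ : ∃ f : Module.Dual ℤ B, f (q (Pi.single i 1)) ≠ 0 := by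
    by_contra! h0
    exact hq ((Module.forall_dual_apply_eq_zero_iff ℤ _).1 h0)
  let w : Fin m → ℤ := fun j => f (q (Pi.single j 1))
  obtain ⟨n, hn, hnw⟩ := h w (fun h0 => hf (congr_fun h0 i))
  refine hnw ?_
  have h4 : n ⬝ᵥ w = f (q n) := by
    conv_rhs => rw [← Finset.univ_sum_single n]
    simp only [map_sum, dotProduct, w]
    refine Finset.sum_congr rfl fun j _ => ?_
    rw [← smul_eq_mul, ← map_smul, ← map_smul, ← Pi.single_smul, smul_eq_mul, mul_one]
  rw [h4]
  have h5 : P.mkQ n = 0 := by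
    rw [← LinearMap.mem_ker, Submodule.ker_mkQ]
    exact hn
  simp [q, h5]

end Torus

theorem fourier_sub_eq_one {k : ℤ} {s t : AddCircle (1 : ℝ)} (h : fourier k s = fourier k t) :
    k • (s - t) = 0 := by
  apply zsmul_eq_zero_of_fourier_eq_one
  rw [fourier_apply, smul_sub, sub_eq_add_neg, AddCircle.toCircle_add, AddCircle.toCircle_neg,
    Circle.coe_mul, Circle.coe_inv, ← fourier_apply, ← fourier_apply, h]
  exact mul_inv_cancel₀ (by simp)

theorem AddCircle.eq_of_zsmul_sub_eq_zero {k : ℤ} (hk : k ≠ 0) {a b : ℝ} (hab : |a - b| < 1 / |k|)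
    (h : k • ((a : AddCircle (1 : ℝ)) - b) = 0) : a = b := by
  rw [← AddCircle.coe_sub, ← AddCircle.coe_zsmul, AddCircle.coe_eq_zero_iff] at h
  obtain ⟨n, hn⟩ := h
  simp only [zsmul_eq_mul, mul_one] at hn
  have hk' : (0 : ℝ) < |k| := by positivity
  have h1 : |(n : ℝ)| < 1 := by
    rw [hn, abs_mul]
    rw [lt_div_iff₀ hk'] at hab
    push_cast at hab
    linarith
  have h2 : n = 0 := Int.abs_lt_one_iff.1 (by exact_mod_cast h1)
  rw [h2] at hn
  have hk2 : (k : ℝ) ≠ 0 := by exact_mod_cast hk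
  have := (mul_eq_zero.1 (hn.symm.trans Int.cast_zero)).resolve_left hk2
  linarith

section Torus
variable {m : ℕ} {X : Type*} [TopologicalSpace X] [AddAction (UnitAddTorus (Fin m)) X]

/-- The projection of Euclidean space onto the torus. -/
def toTorus (τ : EuclideanSpace ℝ (Fin m)) : UnitAddTorus (Fin m) :=
  fun i => (τ i : AddCircle (1 : ℝ))

theorem continuous_toTorus : Continuous (toTorus (m := m)) :=
  continuous_pi fun i => (AddCircle.continuous_mk' 1).comp (by fun_prop)

theorem exists_injOn_toTorus_vadd (x : X)
    (h : ∀ w : Fin m → ℤ, w ≠ 0 → ∃ n ∈ weightsAt x, n ⬝ᵥ w ≠ 0) :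
    ∃ R > 0, InjOn (fun τ : EuclideanSpace ℝ (Fin m) => toTorus τ +ᵥ x) (closedBall 0 R) := by
  choose N hN0 hN using exists_zsmul_single_mem (weightsAt x) h
  have hr : ∀ᶠ R : ℝ in 𝓝[>] 0, ∀ i, R + R < 1 / |N i| := by
    rw [eventually_all]
    intro i
    have h0 : (0 : ℝ) < 1 / |N i| := by have := hN0 i; positivity
    have : Tendsto (fun R : ℝ => R + R) (𝓝[>] 0) (𝓝 0) :=
      tendsto_nhdsWithin_of_tendsto_nhds (by
        simpa using ((by fun_prop : Continuous fun R : ℝ => R + R)).tendsto 0)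
    exact this.eventually_lt_const h0
  obtain ⟨R, hR, hR0⟩ := (hr.and self_mem_nhdsWithin).exists
  refine ⟨R, hR0, fun τ hτ τ' hτ' he => ?_⟩
  ext i
  obtain ⟨v, hv, hvx⟩ := hN i
  have h1 := congr_arg v he
  simp only [hv (toTorus _) x] at h1
  have h2 := mul_right_cancel₀ hvx h1
  have h3 (t : UnitAddTorus (Fin m)) : mFourier (N i • Pi.single i 1) t = fourier (N i) (t i) := by
    change ∏ j, fourier ((N i • Pi.single i 1 : Fin m → ℤ) j) (t j) = _
    rw [Finset.prod_eq_single i (fun j _ hj => by simp [hj]) (by simp)]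
    simp
  rw [h3, h3] at h2
  refine AddCircle.eq_of_zsmul_sub_eq_zero (hN0 i) ?_ (fourier_sub_eq_one h2)
  have h4 : ∀ σ ∈ closedBall (0 : EuclideanSpace ℝ (Fin m)) R, |σ i| ≤ R := fun σ hσ =>
    (PiLp.norm_apply_le σ i).trans (mem_closedBall_zero_iff.1 hσ)
  refine lt_of_le_of_lt ?_ (hR i)
  exact (abs_sub _ _).trans (add_le_add (h4 _ hτ) (h4 _ hτ'))

theorem interior_range_vadd_nonempty [ContinuousVAdd (UnitAddTorus (Fin m)) X]
    [ChartedSpace (EuclideanSpace ℝ (Fin m)) X] (x : X)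
    (h : ∀ w : Fin m → ℤ, w ≠ 0 → ∃ n ∈ weightsAt x, n ⬝ᵥ w ≠ 0) :
    (interior (range fun t : UnitAddTorus (Fin m) => t +ᵥ x)).Nonempty := by
  obtain ⟨R, hR0, hR⟩ := exists_injOn_toTorus_vadd x h
  let g : EuclideanSpace ℝ (Fin m) → X := fun τ => toTorus τ +ᵥ x
  have hg : Continuous g := continuous_toTorus.vadd continuous_const
  let φ := chartAt (EuclideanSpace ℝ (Fin m)) x
  have hg0 : g 0 = x := by
    have : toTorus (0 : EuclideanSpace ℝ (Fin m)) = 0 := by ext; simp [toTorus]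
    simp [g, this]
  have h1 : g ⁻¹' φ.source ∈ 𝓝 0 :=
    hg.continuousAt.preimage_mem_nhds (by rw [hg0]; exact chart_source_mem_nhds _ x)
  obtain ⟨r, hr0, hr⟩ := nhds_basis_closedBall.mem_iff.1 h1
  have hsub : closedBall (0 : EuclideanSpace ℝ (Fin m)) (min R r) ⊆ g ⁻¹' φ.source :=
    (closedBall_subset_closedBall (min_le_right _ _)).trans hr
  obtain ⟨y, hy⟩ := interior_image_closedBall_nonempty (f := φ ∘ g) (lt_min hR0 hr0)
    (φ.continuousOn.comp hg.continuousOn hsub)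
    (φ.injOn.comp (hR.mono (closedBall_subset_closedBall (min_le_left _ _))) hsub)
  have hsubt : interior (φ ∘ g '' closedBall 0 (min R r)) ⊆ φ.target := by
    refine interior_subset.trans ?_
    rintro _ ⟨τ, hτ, rfl⟩
    exact φ.map_source (hsub hτ)
  refine ⟨φ.symm y, mem_interior.2 ⟨_, ?_,
    φ.symm.isOpen_image_of_subset_source isOpen_interior hsubt,
    mem_image_of_mem _ hy⟩⟩
  rintro _ ⟨_, hz, rfl⟩
  obtain ⟨τ, hτ, rfl⟩ := interior_subset hz
  exact ⟨toTorus τ, (φ.left_inv (hsub hτ)).symm⟩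

theorem surjective_vadd_of_interior_nonempty {G Y : Type*} [AddGroup G] [TopologicalSpace G]
    [CompactSpace G] [TopologicalSpace Y] [T2Space Y] [PreconnectedSpace Y] [AddAction G Y]
    [ContinuousVAdd G Y] (x : Y) (h : (interior (range fun t : G => t +ᵥ x)).Nonempty) :
    Function.Surjective fun t : G => t +ᵥ x := by
  have hc : Continuous fun t : G => t +ᵥ x := by fun_prop
  have ho : IsOpen (range fun t : G => t +ᵥ x) := by
    rw [isOpen_iff_mem_nhds]
    rintro _ ⟨t, rfl⟩
    obtain ⟨y, hy⟩ := h
    obtain ⟨s, rfl⟩ := interior_subset hy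
    have h1 : Continuous fun z : Y => (s - t) +ᵥ z := by fun_prop
    have h2 : (fun z : Y => (s - t) +ᵥ z) ⁻¹' (range fun t : G => t +ᵥ x) ∈ 𝓝 (t +ᵥ x) := by
      refine h1.continuousAt.preimage_mem_nhds ?_
      rw [vadd_vadd, sub_add_cancel]
      exact mem_interior_iff_mem_nhds.1 hy
    filter_upwards [h2] with z hz
    obtain ⟨a, ha⟩ := hz
    refine ⟨-(s - t) + a, ?_⟩
    simp only at ha ⊢
    rw [← vadd_vadd, ha, neg_vadd_vadd]
  rw [← range_eq_univ]
  exact IsClopen.eq_univ ⟨(isCompact_range hc).isClosed, ho⟩ ⟨_, 0, rfl⟩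
end Torus

end TorusAction

/-- Let `X` be a closed (compact, connected, boundaryless) topological `m`-manifold
supporting a continuous effective action of the torus `T^m = (ℝ/ℤ)^m`.  Then `X` is
homeomorphic to `T^m`. -/
theorem stmt13 (m : ℕ) (X : Type) [TopologicalSpace X] [T2Space X] [CompactSpace X]
    [ConnectedSpace X] [ChartedSpace (EuclideanSpace ℝ (Fin m)) X]
    [AddAction (Fin m → AddCircle (1 : ℝ)) X]
    [ContinuousVAdd (Fin m → AddCircle (1 : ℝ)) X]
    (heff : ∀ g : Fin m → AddCircle (1 : ℝ), (∀ x : X, g +ᵥ x = x) → g = 0) :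
    Nonempty (X ≃ₜ (Fin m → AddCircle (1 : ℝ))) := by
  obtain ⟨x, hx⟩ := exists_forall_weightsAt_dotProduct_ne_zero (X := X) heff
  have hs := surjective_vadd_of_interior_nonempty x (interior_range_vadd_nonempty x hx)
  have hi : Function.Injective fun t : Fin m → AddCircle (1 : ℝ) => t +ᵥ x := by
    intro t t' htt
    rw [← sub_eq_zero]
    refine heff _ fun y => ?_
    obtain ⟨s, rfl⟩ := hs y
    simp only at htt ⊢
    rw [vadd_vadd, sub_add_eq_add_sub, sub_eq_neg_add, ← vadd_vadd, add_comm t s, ← vadd_vadd, htt,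
      vadd_vadd, vadd_vadd]
    congr 1
    abel
  have hc : Continuous fun t : Fin m → AddCircle (1 : ℝ) => t +ᵥ x := by fun_prop
  exact ⟨(Continuous.homeoOfEquivCompactToT2 (f := Equiv.ofBijective _ ⟨hi, hs⟩) hc).symm⟩
end
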